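/- Let n ≥ 0 and let a_0, a_1, …, a_{2n} be nonnegative integers, and set wt = 4n + 2·(a_0 + a_1 + ⋯ + a_{2n}). Then the sum over all permutations σ of the set {0, 1, …, 2n} of Z(a_{σ(0)}, a_{σ(1)}, …, a_{σ(2n)}) is a rational multiple of π^{wt}: there exists q ∈ ℚ such that ∑_{σ ∈ S_{2n+1}} Z(a_{σ(0)}, a_{σ(1)}, …, a_{σ(2n)}) = q · π^{wt}. -/

import Mathlib

/-- The multiple zeta value `ζ(s₁, …, s_k) = ∑_{0 < n₁ < ⋯ < n_k} n₁^{-s₁} ⋯ n_k^{-s_k}`,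
defined as a `tsum` over strictly increasing tuples of positive integers.
For the empty tuple this gives `ζ() = 1`. -/
noncomputable def MZV (s : List ℕ) : ℝ :=
  ∑' f : { f : Fin s.length → ℕ+ // StrictMono f },
    ∏ i : Fin s.length, (((f.1 i : ℕ) : ℝ) ^ (s.get i))⁻¹

/-- Given the list `[b₀, b₁, …, b_{2n}]`, produce the argument string
`{2}^{b₀}, 1, {2}^{b₁}, 3, {2}^{b₂}, 1, …, 1, {2}^{b_{2n-1}}, 3, {2}^{b_{2n}}`,
i.e. insert the block `{2}^{b_i}` after the `i`-th entry of `1, 3, 1, 3, …, 1, 3`. -/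
def Zargs : List ℕ → List ℕ
  | [] => []
  | [b0] => List.replicate b0 2
  | b0 :: b1 :: rest =>
      List.replicate b0 2 ++ [1] ++ List.replicate b1 2 ++ [3] ++ Zargs rest

/-- `Z(b₀, …, b_{2n}) = ζ({2}^{b₀}, 1, {2}^{b₁}, 3, …, 1, {2}^{b_{2n-1}}, 3, {2}^{b_{2n}})`. -/
noncomputable def Z (b : List ℕ) : ℝ := MZV (Zargs b)

/-- Formal power series over `ℂ` in two noncommuting variables, given by the coefficients of
the words. -/
structure WordSeries where
  /-- The coefficient of a word. -/
  coeff : List Bool → ℂ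

namespace WordSeries

instance : CoeFun WordSeries fun _ => List Bool → ℂ := ⟨coeff⟩

@[ext] lemma ext {f g : WordSeries} (h : ∀ l, f l = g l) : f = g := by
  cases f; cases g; congr; exact funext h

/-- Word series are functions on words. -/
def equivFun : WordSeries ≃ (List Bool → ℂ) := ⟨coeff, mk, fun _ => rfl, fun _ => rfl⟩

noncomputable instance : AddCommGroup WordSeries := equivFun.addCommGroup

noncomputable instance : Module ℂ WordSeries := equivFun.module ℂ

@[simp] lemma add_apply (f g : WordSeries) (l : List Bool) : (f + g) l = f l + g l := rfl
@[simp] lemma sub_apply (f g : WordSeries) (l : List Bool) : (f - g) l = f l - g l := rfl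
@[simp] lemma neg_apply (f : WordSeries) (l : List Bool) : (-f) l = -f l := rfl
@[simp] lemma zero_apply (l : List Bool) : (0 : WordSeries) l = 0 := rfl
@[simp] lemma smul_apply (c : ℂ) (f : WordSeries) (l : List Bool) : (c • f) l = c * f l := rfl

/-- Left derivative: strip the leading letter `a`. -/
def shift (a : Bool) (f : WordSeries) : WordSeries := ⟨fun l => f (a :: l)⟩

@[simp] lemma shift_apply (a : Bool) (f : WordSeries) (l : List Bool) :
    shift a f l = f (a :: l) := rfl

/-- The coefficient of a word in the product of two series. -/
noncomputable def mulCoeff : List Bool → WordSeries → WordSeries → ℂ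
  | [], f, g => f [] * g []
  | a :: l, f, g => f [] * g (a :: l) + mulCoeff l (shift a f) g

noncomputable instance : Mul WordSeries := ⟨fun f g => ⟨fun l => mulCoeff l f g⟩⟩

@[simp] lemma mul_nil (f g : WordSeries) : (f * g) [] = f [] * g [] := rfl

lemma mul_cons (f g : WordSeries) (a : Bool) (l : List Bool) :
    (f * g) (a :: l) = f [] * g (a :: l) + (shift a f * g) l := rfl

noncomputable instance : One WordSeries := ⟨⟨fun l => if l = [] then 1 else 0⟩⟩

lemma one_apply (l : List Bool) : (1 : WordSeries) l = if l = [] then 1 else 0 := rfl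

@[simp] lemma one_nil : (1 : WordSeries) [] = 1 := rfl
@[simp] lemma one_cons (a : Bool) (l : List Bool) : (1 : WordSeries) (a :: l) = 0 := rfl

lemma add_mul_aux (l : List Bool) (f g h : WordSeries) :
    ((f + g) * h) l = (f * h) l + (g * h) l := by
  induction l generalizing f g with
  | nil => simp [add_mul]
  | cons a l ih =>
    have : shift a (f + g) = shift a f + shift a g := rfl
    rw [mul_cons, mul_cons, mul_cons, this, ih, add_apply]; ring

lemma smul_mul_aux (l : List Bool) (c : ℂ) (f h : WordSeries) :
    ((c • f) * h) l = c * (f * h) l := by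
  induction l generalizing f with
  | nil => simp [mul_assoc]
  | cons a l ih =>
    have : shift a (c • f) = c • shift a f := rfl
    rw [mul_cons, mul_cons, this, ih, smul_apply]; ring

lemma mul_add_aux (l : List Bool) (f g h : WordSeries) :
    (f * (g + h)) l = (f * g) l + (f * h) l := by
  induction l generalizing f with
  | nil => simp [mul_add]
  | cons a l ih => rw [mul_cons, mul_cons, mul_cons, ih, add_apply]; ring

lemma mul_smul_aux (l : List Bool) (c : ℂ) (f h : WordSeries) :
    (f * (c • h)) l = c * (f * h) l := by
  induction l generalizing f with
  | nil => simp; ring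
  | cons a l ih => rw [mul_cons, mul_cons, ih, smul_apply]; ring

lemma zero_mul_aux (l : List Bool) (f : WordSeries) : (0 * f) l = 0 := by
  have := smul_mul_aux l 0 0 f
  simpa using this

lemma mul_zero_aux (l : List Bool) (f : WordSeries) : (f * 0) l = 0 := by
  have := mul_smul_aux l 0 f 0
  simpa using this

lemma shift_mul (a : Bool) (f g : WordSeries) :
    shift a (f * g) = f [] • shift a g + shift a f * g := rfl

lemma mul_assoc_aux (l : List Bool) (f g h : WordSeries) :
    (f * g * h) l = (f * (g * h)) l := by
  induction l generalizing f with
  | nil => simp [mul_assoc]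
  | cons a l ih =>
    rw [mul_cons, mul_cons, shift_mul, add_mul_aux, smul_mul_aux, ih, mul_nil, mul_cons]; ring

lemma one_mul_aux (l : List Bool) (f : WordSeries) : (1 * f) l = f l := by
  cases l with
  | nil => simp
  | cons a l =>
    have : shift a (1 : WordSeries) = 0 := rfl
    rw [mul_cons, this, zero_mul_aux]; simp

lemma mul_one_aux (l : List Bool) (f : WordSeries) : (f * 1) l = f l := by
  induction l generalizing f with
  | nil => simp
  | cons a l ih => rw [mul_cons, ih]; simp

noncomputable instance : Ring WordSeries :=
  { (inferInstance : AddCommGroup WordSeries) with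
    mul_assoc := fun f g h => ext fun l => mul_assoc_aux l f g h
    one_mul := fun f => ext fun l => one_mul_aux l f
    mul_one := fun f => ext fun l => mul_one_aux l f
    left_distrib := fun f g h => ext fun l => mul_add_aux l f g h
    right_distrib := fun f g h => ext fun l => add_mul_aux l f g h
    zero_mul := fun f => ext fun l => zero_mul_aux l f
    mul_zero := fun f => ext fun l => mul_zero_aux l f }

instance : IsScalarTower ℂ WordSeries WordSeries :=
  ⟨fun c f g => ext fun l => smul_mul_aux l c f g⟩

instance : SMulCommClass ℂ WordSeries WordSeries :=
  ⟨fun c f g => ext fun l => (mul_smul_aux l c f g).symm⟩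

/-- The series consisting of the single letter `a`. -/
noncomputable def letter (a : Bool) : WordSeries := ⟨fun l => if l = [a] then 1 else 0⟩

@[simp] lemma letter_nil (a : Bool) : letter a [] = 0 := rfl

lemma letter_singleton (a b : Bool) : letter a [b] = if b = a then 1 else 0 := by
  simp [letter]

@[simp] lemma letter_cons_cons (a b c : Bool) (l : List Bool) : letter a (b :: c :: l) = 0 := by
  simp [letter]

lemma letter_mul_cons (a b : Bool) (f : WordSeries) (l : List Bool) :
    (letter a * f) (b :: l) = if b = a then f l else 0 := by
  rw [mul_cons]
  by_cases h : b = a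
  · have : shift b (letter a) = 1 := by
      ext l; simp [letter, one_apply, h]
    rw [this, one_mul]; simp [letter, h]
  · have : shift b (letter a) = 0 := by
      ext l; simp [letter, h]
    rw [this, zero_mul]; simp [letter, h]

lemma mul_letter_concat (a b : Bool) (f : WordSeries) (l : List Bool) :
    (f * letter a) (l ++ [b]) = if b = a then f l else 0 := by
  induction l generalizing f with
  | nil => by_cases h : b = a <;> simp [mul_cons, letter, h]
  | cons c l ih =>
    rw [List.cons_append, mul_cons, ih]
    simp [letter]

/-- Coefficientwise differentiability of a curve of word series. -/
def HasDeriv (F : ℝ → WordSeries) (F' : WordSeries) (t : ℝ) : Prop :=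
  ∀ l, HasDerivAt (fun s => F s l) (F' l) t

lemma HasDeriv.mul {F G : ℝ → WordSeries} {F' G' : WordSeries} {t : ℝ}
    (hF : HasDeriv F F' t) (hG : HasDeriv G G' t) :
    HasDeriv (fun s => F s * G s) (F' * G t + F t * G') t := by
  intro l
  induction l generalizing F F' with
  | nil => simpa using! (hF []).mul (hG [])
  | cons a l ih =>
    have h := ((hF []).mul (hG (a :: l))).add (ih (F := fun s => shift a (F s))
      (F' := shift a F') fun l => hF (a :: l))
    convert! h using 1
    simp only [add_apply, mul_cons]; ring

/-- Real coefficients are preserved by multiplication. -/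
lemma im_mul_eq_zero {f g : WordSeries} (hf : ∀ l, (f l).im = 0) (hg : ∀ l, (g l).im = 0)
    (l : List Bool) : ((f * g) l).im = 0 := by
  induction l generalizing f with
  | nil => simp [hf, hg]
  | cons a l ih =>
    rw [mul_cons, Complex.add_im, ih (f := shift a f) (fun l => hf _)]
    simp [hf, hg]

end WordSeries

section Polylog

open Complex Set

/-- The half plane `Re z < 1`. -/
def leftHalf : Set ℂ := {z | z.re < 1}

lemma isOpen_leftHalf : IsOpen leftHalf := isOpen_lt Complex.continuous_re continuous_const

lemma convex_leftHalf : Convex ℝ leftHalf := convex_halfSpace_re_lt 1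

lemma zero_mem_leftHalf : (0 : ℂ) ∈ leftHalf := by simp [leftHalf]

lemma sub_one_ne_zero_of_mem_leftHalf {z : ℂ} (hz : z ∈ leftHalf) : z - 1 ≠ 0 := by
  intro h
  rw [sub_eq_zero] at h
  simp [leftHalf, h] at hz

lemma exists_primitive {f : ℂ → ℂ} (hf : DifferentiableOn ℂ f leftHalf) :
    ∃ F : ℂ → ℂ, ∀ z ∈ leftHalf, HasDerivAt F (f z) z := by
  obtain ⟨g, hg⟩ := convex_leftHalf.exists_forall_hasDerivWithinAt hf
  exact ⟨g, fun z hz => (hg z hz).hasDerivAt (isOpen_leftHalf.mem_nhds hz)⟩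

open Classical in
/-- The primitive of `f` on the half plane `Re z < 1` that vanishes at the origin. -/
noncomputable def primitive (f : ℂ → ℂ) : ℂ → ℂ :=
  if h : ∃ F : ℂ → ℂ, ∀ z ∈ leftHalf, HasDerivAt F (f z) z then
    fun z => h.choose z - h.choose 0
  else 0

lemma primitive_zero (f : ℂ → ℂ) : primitive f 0 = 0 := by
  unfold primitive; split_ifs <;> simp

lemma hasDerivAt_primitive {f : ℂ → ℂ} (hf : DifferentiableOn ℂ f leftHalf) {z : ℂ}
    (hz : z ∈ leftHalf) : HasDerivAt (primitive f) (f z) z := by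
  have h := exists_primitive hf
  unfold primitive
  rw [dif_pos h]
  exact (h.choose_spec z hz).sub_const _

/-- The derivative of the multiple polylogarithm `polylog (a :: l)`, in terms of those of
smaller length. -/
noncomputable def polylogDeriv (a b : Bool) (f g : ℂ → ℂ) (z : ℂ) : ℂ :=
  (if a then f z / (z - 1) else dslope f 0 z) - (if b then 0 else dslope g 0 z)

/-- The holomorphic part of the multiple polylogarithm attached to a word. The head of the word is
the form that is integrated last; powers of the logarithm at the origin are split off. -/
noncomputable def polylog : List Bool → ℂ → ℂ
  | [] => fun _ => 1
  | a :: l => primitive (polylogDeriv a ((a :: l).getLast (List.cons_ne_nil a l))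
      (polylog l) (polylog (a :: l).dropLast))
termination_by l => l.length

lemma polylog_nil (z : ℂ) : polylog [] z = 1 := by rw [polylog]

lemma polylog_zero {l : List Bool} (h : l ≠ []) : polylog l 0 = 0 := by
  cases l with
  | nil => exact absurd rfl h
  | cons a l => rw [polylog, primitive_zero]

lemma differentiableOn_dslope_zero {f : ℂ → ℂ} (hf : DifferentiableOn ℂ f leftHalf) :
    DifferentiableOn ℂ (dslope f 0) leftHalf :=
  (Complex.differentiableOn_dslope (isOpen_leftHalf.mem_nhds zero_mem_leftHalf)).2 hf

lemma differentiableOn_polylogDeriv (a b : Bool) {f g : ℂ → ℂ}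
    (hf : DifferentiableOn ℂ f leftHalf) (hg : DifferentiableOn ℂ g leftHalf) :
    DifferentiableOn ℂ (polylogDeriv a b f g) leftHalf := by
  unfold polylogDeriv
  refine DifferentiableOn.sub ?_ ?_
  · cases a
    · simpa using differentiableOn_dslope_zero hf
    · simpa using! hf.div (by fun_prop) fun z hz => sub_one_ne_zero_of_mem_leftHalf hz
  · cases b
    · simpa using differentiableOn_dslope_zero hg
    · simp

lemma differentiableOn_polylog (l : List Bool) : DifferentiableOn ℂ (polylog l) leftHalf := by
  induction h : l.length using Nat.strong_induction_on generalizing l with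
  | _ n ih =>
    cases l with
    | nil =>
      rw [polylog]
      exact differentiableOn_const _
    | cons a l =>
      rw [polylog]
      intro z hz
      refine (hasDerivAt_primitive ?_ hz).differentiableAt.differentiableWithinAt
      apply differentiableOn_polylogDeriv
      · exact ih l.length (by simp [← h]) l rfl
      · exact ih _ (by simp [← h]) (a :: l).dropLast rfl

lemma hasDerivAt_polylog_cons (a : Bool) (l : List Bool) {z : ℂ} (hz : z ∈ leftHalf) :
    HasDerivAt (polylog (a :: l)) (polylogDeriv a ((a :: l).getLast (List.cons_ne_nil a l))
      (polylog l) (polylog (a :: l).dropLast) z) z := by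
  rw [polylog]
  exact hasDerivAt_primitive (differentiableOn_polylogDeriv _ _ (differentiableOn_polylog _)
    (differentiableOn_polylog _)) hz

/-- The coefficient of the differential form `dz / z` or `dz / (z - 1)`. -/
noncomputable def form (a : Bool) (z : ℂ) : ℂ := if a then (z - 1)⁻¹ else z⁻¹

lemma polylogDeriv_eq (a : Bool) (l : List Bool) {z : ℂ} (hz : z ≠ 0) :
    polylogDeriv a ((a :: l).getLast (List.cons_ne_nil a l)) (polylog l)
      (polylog (a :: l).dropLast) z = form a z * polylog l z -
        if (a :: l).getLast (List.cons_ne_nil a l) then 0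
        else z⁻¹ * polylog (a :: l).dropLast z := by
  have key : ∀ f : ℂ → ℂ, dslope f 0 z = z⁻¹ * (f z - f 0) := by
    intro f
    rw [dslope_of_ne f hz, slope_def_field]; ring
  unfold polylogDeriv form
  rw [key, key]
  cases l with
  | nil => cases a <;> simp [polylog_nil]
  | cons b l =>
    rw [polylog_zero (List.cons_ne_nil b l), polylog_zero (l := (a :: b :: l).dropLast) (by simp)]
    cases a
    · simp
    · simp [div_eq_inv_mul]

/-- The multiple polylogarithms as a word series; the last letter of a word is the form that is
integrated last. -/
noncomputable def plog (z : ℂ) : WordSeries := ⟨fun l => polylog l.reverse z⟩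

/-- The inverse of `plog`: iterated integrals along the reversed path. -/
noncomputable def plogInv (z : ℂ) : WordSeries := ⟨fun l => (-1) ^ l.length * polylog l z⟩

namespace WordSeries

/-- The connection form. -/
noncomputable def conn (z : ℂ) : WordSeries :=
  z⁻¹ • letter false + (z - 1)⁻¹ • letter true

lemma conn_mul_cons (z : ℂ) (f : WordSeries) (a : Bool) (l : List Bool) :
    (conn z * f) (a :: l) = form a z * f l := by
  rw [conn, add_mul, add_apply, smul_mul_assoc, smul_mul_assoc, smul_apply, smul_apply,
    letter_mul_cons, letter_mul_cons]
  cases a <;> simp [form]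

lemma mul_conn_concat (z : ℂ) (f : WordSeries) (a : Bool) (l : List Bool) :
    (f * conn z) (l ++ [a]) = form a z * f l := by
  rw [conn, mul_add, add_apply, mul_smul_comm, mul_smul_comm, smul_apply, smul_apply,
    mul_letter_concat, mul_letter_concat]
  cases a <;> simp [form]

@[simp] lemma conn_nil (z : ℂ) : conn z [] = 0 := by simp [conn]

lemma hasDeriv_plog {c : ℝ → ℂ} {c' : ℂ} {t : ℝ} (hc : HasDerivAt c c' t)
    (hD : c t ∈ leftHalf) (h0 : c t ≠ 0) :
    HasDeriv (fun s => plog (c s))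
      (c' • (plog (c t) * conn (c t) - (c t)⁻¹ • (letter false * plog (c t)))) t := by
  intro l
  rcases List.eq_nil_or_concat' l with rfl | ⟨l, a, rfl⟩
  · simpa [plog, polylog_nil] using! hasDerivAt_const t (1 : ℂ)
  · have h := (hasDerivAt_polylog_cons a l.reverse hD).comp t hc
    rw [polylogDeriv_eq a _ h0] at h
    convert! h using 1
    · ext s; simp [plog]
    · rw [smul_apply, sub_apply, mul_conn_concat, smul_apply, mul_comm]
      congr 2
      cases l with
      | nil => cases a <;> simp [letter_mul_cons, plog]
      | cons b l =>
        rw [List.cons_append, letter_mul_cons]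
        cases b <;> simp [plog, List.dropLast_cons_of_ne_nil, List.getLast_cons]

lemma hasDeriv_plogInv {c : ℝ → ℂ} {c' : ℂ} {t : ℝ} (hc : HasDerivAt c c' t)
    (hD : c t ∈ leftHalf) (h0 : c t ≠ 0) :
    HasDeriv (fun s => plogInv (c s))
      (c' • ((c t)⁻¹ • (plogInv (c t) * letter false) - conn (c t) * plogInv (c t))) t := by
  intro l
  cases l with
  | nil => simpa [plogInv, polylog_nil] using! hasDerivAt_const t (1 : ℂ)
  | cons a l =>
    have h := ((hasDerivAt_polylog_cons a l hD).comp t hc).const_mul ((-1 : ℂ) ^ (l.length + 1))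
    rw [polylogDeriv_eq a _ h0] at h
    convert! h using 1
    · rw [smul_apply, sub_apply, conn_mul_cons, smul_apply]
      have : (plogInv (c t) * letter false) (a :: l) =
          if (a :: l).getLast (List.cons_ne_nil a l) then 0
          else (-1) ^ l.length * polylog (a :: l).dropLast (c t) := by
        obtain ⟨l', b, hl⟩ := (List.eq_nil_or_concat' (a :: l)).resolve_left (by simp)
        have hlen : l.length = l'.length := by
          have := congrArg List.length hl
          simpa using this
        simp only [hl, mul_letter_concat, hlen]
        cases b <;> simp [plogInv]
      rw [this]
      split_ifs
      · simp [plogInv]; ring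
      · simp [plogInv]; ring

end WordSeries

end Polylog

section TwistedTrace

/-- Rotate a word by one letter, exchanging the two letters of the alphabet in the letter moved. -/
def twist : List Bool → List Bool
  | [] => []
  | a :: l => l ++ [!a]

lemma length_twist (l : List Bool) : (twist l).length = l.length := by
  cases l <;> simp [twist]

lemma length_twist_iterate (m : ℕ) (l : List Bool) : (twist^[m] l).length = l.length := by
  induction m generalizing l with
  | zero => rfl
  | succ m ih => rw [Function.iterate_succ_apply, ih, length_twist]

lemma twist_iterate_append (u v : List Bool) :
    twist^[u.length] (u ++ v) = v ++ u.map not := by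
  induction u generalizing v with
  | nil => simp
  | cons a u ih =>
    rw [List.length_cons, Function.iterate_succ_apply, List.cons_append, twist,
      List.append_assoc, ih]
    simp

lemma twist_iterate_two_mul_length (l : List Bool) : twist^[2 * l.length] l = l := by
  have h := twist_iterate_append l []
  have h2 := twist_iterate_append (l.map not) []
  simp only [List.append_nil, List.length_map, List.nil_append] at h h2
  rw [two_mul, Function.iterate_add_apply, h, h2]
  simp [Function.comp_def]

lemma sum_range_add_of_periodic {M : Type*} [AddCommMonoid M] {f : ℕ → M} {p : ℕ}
    (hf : ∀ i, f (i + p) = f i) (m : ℕ) :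
    ∑ i ∈ Finset.range p, f (i + m) = ∑ i ∈ Finset.range p, f i := by
  induction m with
  | zero => rfl
  | succ m ih =>
    rw [← ih]
    cases p with
    | zero => simp
    | succ p =>
      rw [Finset.sum_range_succ, Finset.sum_range_succ' (fun i => f (i + m))]
      congr 1
      · exact Finset.sum_congr rfl fun i _ => by congr 1; ring
      · rw [← hf (0 + m)]; congr 1; ring

namespace WordSeries

lemma mul_apply_eq_sum (f g : WordSeries) (l : List Bool) :
    (f * g) l = ∑ m ∈ Finset.range (l.length + 1), f (l.take m) * g (l.drop m) := by
  induction l generalizing f with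
  | nil => simp
  | cons a l ih =>
    rw [mul_cons, ih, List.length_cons, Finset.sum_range_succ' _ (l.length + 1)]
    simp [add_comm]

/-- Exchange the two letters of the alphabet. -/
def swap (f : WordSeries) : WordSeries := ⟨fun l => f (l.map not)⟩

@[simp] lemma swap_apply (f : WordSeries) (l : List Bool) : swap f l = f (l.map not) := rfl

/-- The twisted trace property of the sum over all twisted rotations of a word. -/
lemma sum_twist_mul_comm (f g : WordSeries) (w : List Bool) :
    ∑ i ∈ Finset.range (2 * w.length), (f * g) (twist^[i] w) =
      ∑ i ∈ Finset.range (2 * w.length), (g * swap f) (twist^[i] w) := by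
  simp only [mul_apply_eq_sum, length_twist_iterate]
  rw [Finset.sum_comm]
  conv_rhs => rw [Finset.sum_comm]
  rw [← Finset.sum_range_reflect]
  refine Finset.sum_congr rfl fun m hm => ?_
  rw [Finset.mem_range] at hm
  have hk : w.length + 1 - 1 - m = w.length - m := by omega
  rw [hk]
  set k := w.length - m with hk
  rw [← sum_range_add_of_periodic (p := 2 * w.length) (m := k)
    (f := fun i => g ((twist^[i] w).take m) * swap f ((twist^[i] w).drop m))]
  · refine Finset.sum_congr rfl fun i _ => ?_
    set v := twist^[i] w with hv
    have hl : v.length = w.length := length_twist_iterate i w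
    have h := twist_iterate_append (v.take k) (v.drop k)
    rw [List.take_append_drop, List.length_take, min_eq_left (by omega)] at h
    rw [add_comm i k, Function.iterate_add_apply, ← hv, h]
    have hd : (v.drop k).length = m := by rw [List.length_drop]; omega
    rw [List.take_left' hd, List.drop_left' hd, swap_apply]
    simp [Function.comp_def, mul_comm]
  · intro i
    rw [Function.iterate_add_apply, twist_iterate_two_mul_length]

lemma conn_one_sub (z : ℂ) : conn (1 - z) = -swap (conn z) := by
  ext l
  have h1 : (1 - z)⁻¹ = -(z - 1)⁻¹ := by rw [← inv_neg]; ring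
  have h2 : (1 - z - 1)⁻¹ = -z⁻¹ := by rw [← inv_neg]; ring
  have hs : ∀ a, letter a (l.map not) = letter (!a) l := by
    intro a
    have : l.map not = [a] ↔ l = [!a] := by
      rcases l with _ | ⟨b, _ | ⟨c, l⟩⟩ <;> cases a <;> simp
    simp [letter, this]
  simp only [conn, neg_apply, swap_apply, add_apply, smul_apply, hs, h1, h2]
  simp only [Bool.not_false, Bool.not_true]
  ring

end WordSeries

end TwistedTrace

section Monodromy

open Complex Set Filter Topology

namespace WordSeries

lemma tendsto_mul_apply {α : Type*} {L : Filter α} {F G : α → WordSeries} {f g : WordSeries}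
    (hF : ∀ l, Tendsto (fun x => F x l) L (𝓝 (f l)))
    (hG : ∀ l, Tendsto (fun x => G x l) L (𝓝 (g l))) (l : List Bool) :
    Tendsto (fun x => (F x * G x) l) L (𝓝 ((f * g) l)) := by
  simp only [mul_apply_eq_sum]
  exact tendsto_finsetSum _ fun m _ => (hF _).mul (hG _)

lemma tendsto_plog {α : Type*} {L : Filter α} {c : α → ℂ} {z : ℂ} (hz : z ∈ leftHalf)
    (hc : Tendsto c L (𝓝 z)) (l : List Bool) :
    Tendsto (fun x => plog (c x) l) L (𝓝 (plog z l)) :=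
  (((differentiableOn_polylog l.reverse).differentiableAt
    (isOpen_leftHalf.mem_nhds hz)).continuousAt.tendsto.comp hc :)

lemma tendsto_plogInv {α : Type*} {L : Filter α} {c : α → ℂ} {z : ℂ} (hz : z ∈ leftHalf)
    (hc : Tendsto c L (𝓝 z)) (l : List Bool) :
    Tendsto (fun x => plogInv (c x) l) L (𝓝 (plogInv z l)) :=
  ((((differentiableOn_polylog l).differentiableAt
    (isOpen_leftHalf.mem_nhds hz)).continuousAt.tendsto.comp hc).const_mul _ :)

lemma plog_zero : plog 0 = 1 := by
  ext l
  cases l with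
  | nil => simp [plog, polylog_nil]
  | cons a l => simp only [plog, one_cons]; exact polylog_zero (by simp)

lemma plogInv_zero : plogInv 0 = 1 := by
  ext l
  cases l with
  | nil => simp [plogInv, polylog_nil]
  | cons a l => simp only [plogInv, one_cons]; rw [polylog_zero (by simp), mul_zero]

lemma eq_of_hasDerivAt_zero {f : ℝ → ℂ} {b : ℝ} (hb : 0 < b) (hc : ContinuousOn f (Icc 0 b))
    (hd : ∀ t ∈ Ioo (0 : ℝ) b, HasDerivAt f 0 t) : f b = f 0 := by
  have aux : ∀ (L : ℂ →L[ℝ] ℝ), L (f b) = L (f 0) := by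
    intro L
    obtain ⟨t, ht, h⟩ := exists_hasDerivAt_eq_slope (fun t => L (f t)) (fun _ => 0) hb
      (L.continuous.comp_continuousOn hc)
      (fun t ht => by simpa using! L.hasFDerivAt.comp_hasDerivAt t (hd t ht))
    have : L (f b) - L (f 0) = 0 := by simpa [hb.ne'] using h.symm
    linarith
  exact Complex.ext (aux Complex.reCLM) (aux Complex.imCLM)

lemma plogInv_mul_plog {z : ℂ} (hz : z ∈ leftHalf) : plogInv z * plog z = 1 := by
  by_cases h0 : z = 0
  · rw [h0, plog_zero, plogInv_zero, one_mul]
  have hmem : ∀ s ∈ Icc (0 : ℝ) 1, (s : ℂ) * z ∈ leftHalf := by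
    rintro s ⟨hs0, hs1⟩
    have : z.re < 1 := hz
    show ((s : ℂ) * z).re < 1
    rw [re_ofReal_mul]
    rcases le_total z.re 0 with h | h <;> nlinarith
  have key : ∀ n : ℕ, ∀ l : List Bool, l.length = n → ∀ s ∈ Icc (0 : ℝ) 1,
      (plogInv (s * z) * plog (s * z)) l = (1 : WordSeries) l := by
    intro n
    induction n using Nat.strong_induction_on with
    | _ n ih =>
      intro l hl s hs
      have hcont : ContinuousOn (fun t : ℝ =>
          (plogInv ((t * s : ℝ) * z) * plog ((t * s : ℝ) * z)) l) (Icc 0 1) := by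
        intro t ht
        have hm : ((t * s : ℝ) : ℂ) * z ∈ leftHalf :=
          hmem _ ⟨mul_nonneg ht.1 hs.1, mul_le_one₀ ht.2 hs.1 hs.2⟩
        have hct : Tendsto (fun t : ℝ => ((t * s : ℝ) : ℂ) * z) (𝓝[Icc 0 1] t)
            (𝓝 (((t * s : ℝ) : ℂ) * z)) := by
          apply Continuous.continuousWithinAt
          fun_prop
        exact tendsto_mul_apply (tendsto_plogInv hm hct) (tendsto_plog hm hct) l
      have hder : ∀ t ∈ Ioo (0 : ℝ) 1, HasDerivAt (fun t : ℝ =>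
          (plogInv ((t * s : ℝ) * z) * plog ((t * s : ℝ) * z)) l) 0 t := by
        intro t ht
        rcases hs.1.eq_or_lt with rfl | hs0
        · simpa using hasDerivAt_const t _
        have hI : t * s ∈ Icc (0 : ℝ) 1 :=
          ⟨mul_nonneg ht.1.le hs.1, mul_le_one₀ ht.2.le hs.1 hs.2⟩
        have hm := hmem _ hI
        have hne : ((t * s : ℝ) : ℂ) * z ≠ 0 :=
          mul_ne_zero (by exact_mod_cast (mul_pos ht.1 hs0).ne') h0
        have hc : HasDerivAt (fun t : ℝ => ((t * s : ℝ) : ℂ) * z) (s * z) t := by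
          have := ((hasDerivAt_id t).ofReal_comp.mul_const (s : ℂ)).mul_const z
          simpa using! this
        have h := (hasDeriv_plogInv hc hm hne).mul (hasDeriv_plog hc hm hne) l
        convert h using 1
        set x := ((t * s : ℝ) : ℂ) * z
        set K := plogInv x * plog x with hK
        have e : ((s * z) • (x⁻¹ • (plogInv x * letter false) - conn x * plogInv x)) * plog x +
            plogInv x * ((s * z) • (plog x * conn x - x⁻¹ • (letter false * plog x))) =
            (s * z) • (K * conn x - conn x * K) := by
          rw [hK]
          simp only [smul_mul_assoc, mul_smul_comm, sub_mul, mul_sub, mul_assoc, smul_sub]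
          abel
        rw [e, smul_apply, sub_apply]
        have hKs : ∀ m : List Bool, m.length < n → K m = (1 : WordSeries) m :=
          fun m hm' => ih _ hm' m rfl _ hI
        rcases l with _ | ⟨a, l⟩
        · simp
        · obtain ⟨l', b, hl'⟩ := (List.eq_nil_or_concat' (a :: l)).resolve_left (by simp)
          have hlen : l.length = l'.length := by
            have := congrArg List.length hl'
            simpa using this
          rw [conn_mul_cons, hKs l (by simp [← hl])]
          rw [hl', mul_conn_concat, hKs l' (by simp [← hl, hlen])]
          rcases l with _ | ⟨c, l⟩
          · have : l' = [] := List.eq_nil_of_length_eq_zero (by simpa using hlen.symm)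
            subst this
            simp at hl'
            simp [hl']
          · have : l' ≠ [] := by rintro rfl; simp at hlen
            obtain ⟨d, l'', rfl⟩ := List.exists_cons_of_ne_nil this
            simp
      have := eq_of_hasDerivAt_zero one_pos hcont hder
      simpa [plog_zero, plogInv_zero] using this
  ext l
  simpa using key _ l rfl 1 (by simp)

/-- The exponential of a multiple of the letter `false`. -/
noncomputable def expLetter (c : ℂ) : WordSeries :=
  ⟨fun l => if true ∈ l then 0 else c ^ l.length / l.length.factorial⟩

lemma letter_mul_expLetter (c : ℂ) :
    letter false * expLetter c = expLetter c * letter false := by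
  ext l
  rcases l with _ | ⟨a, l⟩
  · simp
  rw [letter_mul_cons]
  obtain ⟨l', b, hl'⟩ := (List.eq_nil_or_concat' (a :: l)).resolve_left (by simp)
  have hlen : l.length = l'.length := by
    have := congrArg List.length hl'
    simpa using this
  have hmem : true ∈ a :: l ↔ true ∈ l' ++ [b] := by rw [hl']
  rw [hl', mul_letter_concat]
  simp only [expLetter, hlen]
  simp only [List.mem_cons, List.mem_append] at hmem
  cases a <;> cases b <;> simp at hmem ⊢ <;> simp [hmem]

lemma hasDeriv_expLetter {c : ℝ → ℂ} {c' : ℂ} {t : ℝ} (hc : HasDerivAt c c' t) :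
    HasDeriv (fun s => expLetter (c s)) (c' • (letter false * expLetter (c t))) t := by
  intro l
  rcases l with _ | ⟨a, l⟩
  · simpa [expLetter] using! hasDerivAt_const t (1 : ℂ)
  rw [smul_apply, letter_mul_cons]
  cases a
  · by_cases h : true ∈ l
    · simpa [expLetter, h] using! hasDerivAt_const t (0 : ℂ)
    · have := (hc.pow (l.length + 1)).div_const ((l.length + 1).factorial : ℂ)
      simp only [expLetter, List.mem_cons, h, List.length_cons]
      convert! this using 1
      simp [Nat.factorial_succ]
      have h1 : (l.length.factorial : ℂ) ≠ 0 := by exact_mod_cast l.length.factorial_ne_zero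
      have h2 : ((l.length : ℂ) + 1) ≠ 0 := by exact_mod_cast l.length.succ_ne_zero
      field_simp
  · simpa [expLetter] using! hasDerivAt_const t (0 : ℂ)

lemma expLetter_zero : expLetter 0 = 1 := by
  ext l
  cases l <;> simp [expLetter]

/-- The transport of the connection from `z` to `w`, the logarithm at the origin being `c`. -/
noncomputable def transport (z w c : ℂ) : WordSeries := plogInv z * expLetter c * plog w

lemma hasDeriv_transport {z w c : ℝ → ℂ} {z' w' c' : ℂ} {t : ℝ} (hz : HasDerivAt z z' t)
    (hw : HasDerivAt w w' t) (hc : HasDerivAt c c' t) (hzD : z t ∈ leftHalf)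
    (hz0 : z t ≠ 0) (hwD : w t ∈ leftHalf) (hw0 : w t ≠ 0)
    (h : z' * (z t)⁻¹ + c' - w' * (w t)⁻¹ = 0) :
    HasDeriv (fun s => transport (z s) (w s) (c s))
      (w' • (transport (z t) (w t) (c t) * conn (w t)) -
        z' • (conn (z t) * transport (z t) (w t) (c t))) t := by
  have h1 := ((hasDeriv_plogInv hz hzD hz0).mul (hasDeriv_expLetter hc)).mul
    (hasDeriv_plog hw hwD hw0)
  convert! h1 using 1
  have e : plogInv (z t) * expLetter (c t) * (letter false * plog (w t)) =
      plogInv (z t) * (letter false * expLetter (c t)) * plog (w t) := by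
    rw [letter_mul_expLetter]; simp only [mul_assoc]
  have hc' : c' = w' * (w t)⁻¹ - z' * (z t)⁻¹ := by linear_combination h
  simp only [transport, smul_mul_assoc, mul_smul_comm, sub_mul, mul_sub, add_mul, smul_sub]
  rw [e, hc']
  simp only [mul_assoc, smul_smul, sub_smul]
  abel

end WordSeries

end Monodromy

section Asymptotics

open Complex Set Filter Topology

namespace WordSeries

lemma transport_nil (z w c : ℂ) : transport z w c [] = 1 := by
  simp [transport, plogInv, plog, expLetter, polylog_nil]

lemma transport_self_zero {z : ℂ} (hz : z ∈ leftHalf) : transport z z 0 = 1 := by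
  rw [transport, expLetter_zero, mul_one, plogInv_mul_plog hz]

/-- The sum over all twisted rotations of the transport along the reflection `z ↦ 1 - z` does not
depend on the point of the critical line. -/
lemma sum_twist_transport_eq (W : List Bool) (y : ℝ) :
    ∑ i ∈ Finset.range (2 * W.length), transport (1 / 2 + y * I) (1 / 2 - y * I)
        (log (1 / 2 - y * I) - log (1 / 2 + y * I) + 2 * Real.pi * I) (twist^[i] W) =
      ∑ i ∈ Finset.range (2 * W.length),
        transport (1 / 2) (1 / 2) (2 * Real.pi * I) (twist^[i] W) := by
  set F : ℝ → ℂ := fun y => ∑ i ∈ Finset.range (2 * W.length),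
    transport (1 / 2 + y * I) (1 / 2 - y * I)
        (log (1 / 2 - y * I) - log (1 / 2 + y * I) + 2 * Real.pi * I) (twist^[i] W) with hF
  have hder : ∀ t, HasDerivAt F 0 t := by
    intro t
    have hz : HasDerivAt (fun s : ℝ => (1 / 2 + s * I : ℂ)) I t := by
      simpa using! ((hasDerivAt_id t).ofReal_comp.mul_const I).const_add (1 / 2 : ℂ)
    have hw : HasDerivAt (fun s : ℝ => (1 / 2 - s * I : ℂ)) (-I) t := by
      simpa using! ((hasDerivAt_id t).ofReal_comp.mul_const I).const_sub (1 / 2 : ℂ)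
    have hzr : (1 / 2 + t * I : ℂ).re = 1 / 2 := by simp
    have hwr : (1 / 2 - t * I : ℂ).re = 1 / 2 := by simp
    have hzs : (1 / 2 + t * I : ℂ) ∈ slitPlane := Or.inl (by rw [hzr]; norm_num)
    have hws : (1 / 2 - t * I : ℂ) ∈ slitPlane := Or.inl (by rw [hwr]; norm_num)
    have hc : HasDerivAt (fun s : ℝ => log (1 / 2 - s * I) - log (1 / 2 + s * I) +
        2 * Real.pi * I) (-I / (1 / 2 - t * I) - I / (1 / 2 + t * I)) t :=
      ((hw.clog_real hws).sub (hz.clog_real hzs)).add_const _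
    have hzD : (1 / 2 + t * I : ℂ) ∈ leftHalf := by
      show (1 / 2 + t * I : ℂ).re < 1
      rw [hzr]; norm_num
    have hwD : (1 / 2 - t * I : ℂ) ∈ leftHalf := by
      show (1 / 2 - t * I : ℂ).re < 1
      rw [hwr]; norm_num
    have h := hasDeriv_transport hz hw hc hzD (slitPlane_ne_zero hzs) hwD
      (slitPlane_ne_zero hws) (by ring)
    have h2 := HasDerivAt.fun_sum (u := Finset.range (2 * W.length))
      fun i _ => h (twist^[i] W)
    refine h2.congr_deriv ?_
    set X := transport (1 / 2 + t * I) (1 / 2 - t * I)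
        (log (1 / 2 - t * I) - log (1 / 2 + t * I) + 2 * Real.pi * I)
    have e : (1 / 2 - t * I : ℂ) = 1 - (1 / 2 + t * I) := by ring
    rw [e, conn_one_sub]
    simp only [sub_apply, smul_apply, mul_neg, neg_mul, neg_neg, neg_apply]
    rw [Finset.sum_sub_distrib, ← Finset.mul_sum, ← Finset.mul_sum, sum_twist_mul_comm (conn _) X]
    ring
  have := is_const_of_deriv_eq_zero (fun t => (hder t).differentiableAt)
    (fun t => (hder t).deriv) y 0
  simpa [hF] using this

/-- The point of the half circle of radius `y` around `1 / 2`. -/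
noncomputable def arc (y s : ℝ) : ℂ := 1 / 2 + y * I * exp (s * I)

lemma arc_re (y s : ℝ) : (arc y s).re = 1 / 2 - y * Real.sin s := by
  rw [arc, exp_mul_I]
  simp [sin_ofReal_re, cos_ofReal_im]; ring

lemma arc_im (y s : ℝ) : (arc y s).im = y * Real.cos s := by
  rw [arc, exp_mul_I]
  simp [cos_ofReal_re, sin_ofReal_im]

lemma arc_mem {y s : ℝ} (hy : 1 ≤ y) (hs : s ∈ Icc 0 Real.pi) :
    arc y s ∈ leftHalf ∧ -arc y s ∈ slitPlane := by
  have hsin := Real.sin_nonneg_of_mem_Icc hs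
  constructor
  · show (arc y s).re < 1
    rw [arc_re]
    nlinarith
  · by_cases h : Real.cos s = 0
    · left
      rw [neg_re, arc_re]
      have h1 := Real.sin_sq_add_cos_sq s
      rw [h] at h1
      have : Real.sin s = 1 := by nlinarith
      rw [this]; linarith
    · right
      rw [neg_im, arc_im]
      have : y ≠ 0 := by linarith
      simp [h, this]

lemma norm_arc_sub_half {y s : ℝ} (hy : 1 ≤ y) : ‖arc y s - 1 / 2‖ = y := by
  rw [arc, add_sub_cancel_left, norm_mul, norm_mul, norm_exp_ofReal_mul_I]
  simp; linarith

lemma hasDerivAt_arc (y s : ℝ) : HasDerivAt (arc y) (I * (arc y s - 1 / 2)) s := by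
  have h1 : HasDerivAt (fun s : ℝ => (s : ℂ) * I) I s := by
    simpa using! (hasDerivAt_id s).ofReal_comp.mul_const I
  have := (h1.cexp.const_mul (y * I : ℂ)).const_add (1 / 2 : ℂ)
  convert! this using 1
  rw [arc]; ring

lemma norm_form_arc_le {y s : ℝ} (hy : 1 ≤ y) (a : Bool) :
    ‖(arc y s - 1 / 2) * form a (arc y s) - 1‖ ≤ 1 / y := by
  have hn := norm_arc_sub_half (s := s) hy
  set w := arc y s
  obtain ⟨b, hb, hf⟩ : ∃ b : ℂ, ‖b - 1 / 2‖ = 1 / 2 ∧ form a w = (w - b)⁻¹ := by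
    cases a
    · exact ⟨0, by norm_num, by simp [form]⟩
    · exact ⟨1, by norm_num, by simp [form]⟩
  have h1 : y / 2 ≤ ‖w - b‖ := by
    have : ‖w - 1 / 2‖ ≤ ‖w - b‖ + ‖b - 1 / 2‖ := by
      have := norm_add_le (w - b) (b - 1 / 2)
      simpa using this
    rw [hn, hb] at this
    linarith
  have h2 : w - b ≠ 0 := by
    rw [← norm_pos_iff]; linarith
  have e : (w - 1 / 2) * form a w - 1 = (b - 1 / 2) / (w - b) := by
    rw [hf]; field_simp; ring
  rw [e, norm_div, hb, div_le_div_iff₀ (by linarith) (by linarith)]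
  linarith

lemma transport_arc_bound (w : List Bool) : ∃ C : ℝ, 0 ≤ C ∧ ∀ y : ℝ, 1 ≤ y →
    ∀ s ∈ Icc 0 Real.pi, ‖transport (arc y 0) (arc y s) (log (-arc y s) - log (-arc y 0)) w -
      (s * I) ^ w.length / w.length.factorial‖ ≤ C / y := by
  induction w using List.reverseRecOn with
  | nil => exact ⟨0, le_rfl, fun y _ s _ => by simp [transport_nil]⟩
  | append_singleton v a ih =>
    obtain ⟨C, hC0, hC⟩ := ih
    set n := v.length with hn
    refine ⟨(2 * C + Real.pi ^ n) * Real.pi, by positivity, fun y hy s hs => ?_⟩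
    have hy0 : 0 < y := by linarith
    set X : ℝ → WordSeries := fun s =>
      transport (arc y 0) (arc y s) (log (-arc y s) - log (-arc y 0)) with hX
    set g : ℝ → ℂ := fun s => X s (v ++ [a]) - (s * I) ^ (n + 1) / (n + 1).factorial with hg
    have hg' : ∀ t ∈ Icc 0 Real.pi, HasDerivAt g
        (I * (arc y t - 1 / 2) * form a (arc y t) * X t v - I * ((t * I) ^ n / n.factorial)) t := by
      intro t ht
      obtain ⟨hD, hS⟩ := arc_mem hy ht
      obtain ⟨hD0, hS0⟩ := arc_mem hy (s := 0) ⟨le_rfl, Real.pi_pos.le⟩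
      have hne : arc y t ≠ 0 := fun h => slitPlane_ne_zero hS (by simp [h])
      have hne0 : arc y 0 ≠ 0 := fun h => slitPlane_ne_zero hS0 (by simp [h])
      have hc : HasDerivAt (fun s : ℝ => log (-arc y s) - log (-arc y 0))
          (-(I * (arc y t - 1 / 2)) / (-arc y t)) t :=
        ((hasDerivAt_arc y t).neg.clog_real hS).sub_const _
      have h := hasDeriv_transport (hasDerivAt_const t (arc y 0)) (hasDerivAt_arc y t) hc
        hD0 hne0 hD hne (by field_simp; ring) (v ++ [a])
      refine (h.sub (g' := I * ((t * I) ^ n / n.factorial)) ?_).congr_deriv ?_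
      · have h1 : HasDerivAt (fun s : ℝ => (s : ℂ) * I) I t := by
          simpa using! (hasDerivAt_id t).ofReal_comp.mul_const I
        have h2 := (h1.pow (n + 1)).div_const ((n + 1).factorial : ℂ)
        convert! h2 using 1
        have e1 : (n.factorial : ℂ) ≠ 0 := by exact_mod_cast n.factorial_ne_zero
        have e2 : ((n : ℂ) + 1) ≠ 0 := by exact_mod_cast n.succ_ne_zero
        simp [Nat.factorial_succ]
        field_simp
      · simp only [sub_apply, smul_apply, mul_conn_concat, zero_mul, sub_zero]
        ring
    have hbound : ∀ t ∈ Ico 0 Real.pi, ‖I * (arc y t - 1 / 2) * form a (arc y t) * X t v -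
        I * ((t * I) ^ n / n.factorial)‖ ≤ (2 * C + Real.pi ^ n) / y := by
      intro t ht
      have ht' : t ∈ Icc 0 Real.pi := ⟨ht.1, ht.2.le⟩
      have h1 := hC y hy t ht'
      have h2 := norm_form_arc_le (s := t) hy a
      set D := X t v - (t * I) ^ n / n.factorial with hD
      set ε := (arc y t - 1 / 2) * form a (arc y t) - 1 with hε
      have hp : ‖((t * I) ^ n / n.factorial : ℂ)‖ ≤ Real.pi ^ n := by
        rw [norm_div, norm_pow, norm_mul, norm_I, mul_one, norm_real, Real.norm_of_nonneg ht.1,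
          Complex.norm_natCast]
        have : (1 : ℝ) ≤ n.factorial := by exact_mod_cast n.factorial_pos
        calc t ^ n / n.factorial ≤ t ^ n := div_le_self (pow_nonneg ht.1 _) this
          _ ≤ Real.pi ^ n := pow_le_pow_left₀ ht.1 ht.2.le _
      have e : I * (arc y t - 1 / 2) * form a (arc y t) * X t v - I * ((t * I) ^ n / n.factorial) =
          I * (D + ε * (D + (t * I) ^ n / n.factorial)) := by
        rw [hD, hε]; ring
      rw [e, norm_mul, norm_I, one_mul]
      calc ‖D + ε * (D + (t * I) ^ n / n.factorial)‖
          ≤ ‖D‖ + ‖ε‖ * (‖D‖ + ‖((t * I) ^ n / n.factorial : ℂ)‖) := by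
            refine (norm_add_le _ _).trans ?_
            rw [norm_mul]
            gcongr
            exact norm_add_le _ _
        _ ≤ C / y + 1 / y * (C + Real.pi ^ n) := by
            gcongr
            exact h1.trans (div_le_self hC0 hy)
        _ = _ := by ring
    have h := norm_image_sub_le_of_norm_deriv_le_segment'
      (fun t ht => (hg' t ht).hasDerivWithinAt) hbound s hs
    have hg0 : g 0 = 0 := by
      have := (arc_mem hy (s := 0) ⟨le_rfl, Real.pi_pos.le⟩).1
      simp [hg, hX, transport_self_zero this, one_apply]
    rw [hg0, sub_zero] at h
    have hl : (v ++ [a]).length = n + 1 := by simp [hn]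
    rw [hl]
    refine h.trans ?_
    have : (2 * C + Real.pi ^ n) * Real.pi / y = (2 * C + Real.pi ^ n) / y * Real.pi := by ring
    rw [this, sub_zero]
    gcongr
    exact hs.2

lemma log_neg_sub_log_neg {y : ℝ} (hy : 0 < y) :
    log (-(1 / 2 - y * I)) - log (-(1 / 2 + y * I)) =
      log (1 / 2 - y * I) - log (1 / 2 + y * I) + 2 * Real.pi * I := by
  have h1 : 0 < (1 / 2 + y * I : ℂ).im := by simpa
  have h2 : (1 / 2 - y * I : ℂ).im < 0 := by simpa
  rw [log, log, log, log, norm_neg, norm_neg, arg_neg_eq_arg_sub_pi_of_im_pos h1,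
    arg_neg_eq_arg_add_pi_of_im_neg h2]
  push_cast; ring

/-- The value of the cyclic sum of the transport, computed at infinity. -/
lemma sum_twist_transport (W : List Bool) :
    ∑ i ∈ Finset.range (2 * W.length),
        transport (1 / 2) (1 / 2) (2 * Real.pi * I) (twist^[i] W) =
      2 * W.length * ((Real.pi * I) ^ W.length / W.length.factorial) := by
  have hlim : Tendsto (fun y : ℝ => ∑ i ∈ Finset.range (2 * W.length),
      transport (arc y 0) (arc y Real.pi) (log (-arc y Real.pi) - log (-arc y 0)) (twist^[i] W))
      atTop (𝓝 (∑ i ∈ Finset.range (2 * W.length),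
        ((Real.pi * I) ^ W.length / W.length.factorial : ℂ))) := by
    refine tendsto_finsetSum _ fun i _ => ?_
    obtain ⟨C, hC0, hC⟩ := transport_arc_bound (twist^[i] W)
    rw [tendsto_iff_norm_sub_tendsto_zero]
    refine squeeze_zero' (Eventually.of_forall fun _ => norm_nonneg _) ?_
      (tendsto_const_nhds.div_atTop tendsto_id : Tendsto (fun y : ℝ => C / y) atTop (𝓝 0))
    filter_upwards [eventually_ge_atTop 1] with y hy
    have := hC y hy Real.pi ⟨Real.pi_pos.le, le_rfl⟩
    rwa [length_twist_iterate] at this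
  have hconst : (fun _ : ℝ => ∑ i ∈ Finset.range (2 * W.length),
        transport (1 / 2) (1 / 2) (2 * Real.pi * I) (twist^[i] W)) =ᶠ[atTop]
      (fun y : ℝ => ∑ i ∈ Finset.range (2 * W.length),
      transport (arc y 0) (arc y Real.pi) (log (-arc y Real.pi) - log (-arc y 0))
        (twist^[i] W)) := by
    filter_upwards [eventually_gt_atTop 0] with y hy
    have e0 : arc y 0 = 1 / 2 + y * I := by simp [arc]
    have e1 : arc y Real.pi = 1 / 2 - y * I := by simp [arc, exp_pi_mul_I]; ring
    rw [← sum_twist_transport_eq W y, e0, e1, log_neg_sub_log_neg hy]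
  have := tendsto_nhds_unique (tendsto_const_nhds.congr' hconst) hlim
  rw [this]
  simp

lemma polylog_im (l : List Bool) {x : ℝ} (hx : x ∈ Ico (0 : ℝ) 1) : (polylog l x).im = 0 := by
  induction h : l.length using Nat.strong_induction_on generalizing l x with
  | _ n ih =>
    cases l with
    | nil => simp [polylog_nil]
    | cons a l =>
      rcases hx.1.eq_or_lt with rfl | hx0
      · simp [polylog_zero]
      have hmem : ∀ t ∈ Icc 0 x, (t : ℂ) ∈ leftHalf := fun t ht => by
        show (t : ℂ).re < 1
        rw [ofReal_re]; exact ht.2.trans_lt hx.2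
      have hd : ∀ t ∈ Icc 0 x, HasDerivAt (fun t : ℝ => (polylog (a :: l) t).im)
          (polylogDeriv a ((a :: l).getLast (List.cons_ne_nil a l))
            (polylog l) (polylog (a :: l).dropLast) t).im t := by
        intro t ht
        have h1 := (hasDerivAt_polylog_cons a l (hmem t ht)).comp_ofReal
        exact imCLM.hasFDerivAt.comp_hasDerivAt t h1
      obtain ⟨t, ht, hs⟩ := exists_hasDerivAt_eq_slope (fun t : ℝ => (polylog (a :: l) t).im) _ hx0
        (fun t ht => (hd t ht).continuousAt.continuousWithinAt)
        (fun t ht => hd t ⟨ht.1.le, ht.2.le⟩)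
      have hform : ∀ a, (form a (t : ℂ)).im = 0 := by
        intro a
        have : form a (t : ℂ) = ((if a then (t - 1)⁻¹ else t⁻¹ : ℝ) : ℂ) := by
          cases a <;> simp [form]
        rw [this, ofReal_im]
      have ht1 : t ∈ Ico (0 : ℝ) 1 := ⟨ht.1.le, ht.2.trans hx.2⟩
      have hz : (polylogDeriv a ((a :: l).getLast (List.cons_ne_nil a l))
            (polylog l) (polylog (a :: l).dropLast) t).im = 0 := by
        rw [polylogDeriv_eq a l (by exact_mod_cast ht.1.ne')]
        have h1 := ih l.length (by simp [← h]) l ht1 rfl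
        have h2 := ih _ (by simp [← h]) (a :: l).dropLast ht1 rfl
        have h3 : ((t : ℂ)⁻¹).im = 0 := by rw [← ofReal_inv, ofReal_im]
        rw [sub_im, mul_im, h1, hform]
        split_ifs
        · simp
        · rw [mul_im, h2, h3]; simp
      rw [hz] at hs
      have := hs.symm
      rw [div_eq_zero_iff] at this
      rcases this with h | h
      · simpa [polylog_zero] using h
      · linarith

lemma plog_im {x : ℝ} (hx : x ∈ Ico (0 : ℝ) 1) (l : List Bool) : (plog x l).im = 0 :=
  polylog_im _ hx

lemma plogInv_im {x : ℝ} (hx : x ∈ Ico (0 : ℝ) 1) (l : List Bool) : (plogInv x l).im = 0 := by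
  have : ((-1 : ℂ) ^ l.length) = (((-1 : ℝ) ^ l.length : ℝ) : ℂ) := by simp
  simp only [plogInv]
  rw [this, im_ofReal_mul, polylog_im _ hx, mul_zero]

lemma letter_im (a : Bool) (l : List Bool) : (letter a l).im = 0 := by
  simp only [letter]; split_ifs <;> simp

/-- The remainder of the exponential of a letter after two terms. -/
noncomputable def expTail (c : ℂ) : WordSeries :=
  ⟨fun l => if true ∈ l then 0 else c ^ (l.length + 2) / (l.length + 2).factorial⟩

lemma expLetter_eq (c : ℂ) :
    expLetter c = 1 + c • letter false + letter false * (letter false * expTail c) := by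
  ext l
  rcases l with _ | ⟨a, _ | ⟨b, l⟩⟩
  · simp [expLetter]
  · cases a <;> simp [expLetter, letter_singleton, letter_mul_cons]
  · cases a <;> cases b <;> simp [expLetter, letter_mul_cons, expTail]

/-- The cyclic sum identity at the point `1 / 2`. -/
lemma re_sum_twist_eq {W : List Bool} (hW : W ≠ []) :
    (∑ i ∈ Finset.range (2 * W.length), (letter false * (letter false *
      (expTail (2 * Real.pi * I) * (plog (1 / 2) * swap (plogInv (1 / 2))))))
        (twist^[i] W)).re =
      (2 * W.length * ((Real.pi * I) ^ W.length / W.length.factorial) : ℂ).re := by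
  rw [← sum_twist_transport W]
  have hhalf : (1 / 2 : ℝ) ∈ Ico (0 : ℝ) 1 := by norm_num
  have hJ := plogInv_im hhalf
  have hL := plog_im hhalf
  push_cast at hJ hL
  set J := plogInv (1 / 2)
  set L := plog (1 / 2)
  set c : ℂ := 2 * Real.pi * I with hc
  have e : transport (1 / 2) (1 / 2) c = 1 + c • (J * letter false * L) +
      J * (letter false * (letter false * (expTail c * L))) := by
    have h1 : J * L = 1 := plogInv_mul_plog (by simp [leftHalf]; norm_num)
    rw [transport, expLetter_eq]
    change J * _ * L = _
    simp only [mul_add, add_mul, mul_one, mul_assoc, mul_smul_comm, smul_mul_assoc, h1]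
  have hne : ∀ i, twist^[i] W ≠ [] := fun i h => hW (by
    have := length_twist_iterate i W
    rw [h] at this
    exact List.eq_nil_of_length_eq_zero this.symm)
  rw [e]
  simp only [add_apply, smul_apply, one_apply, hne, if_false, zero_add]
  rw [Finset.sum_add_distrib, ← Finset.mul_sum, sum_twist_mul_comm J]
  have hreal :
      (∑ i ∈ Finset.range (2 * W.length), (J * letter false * L) (twist^[i] W)).im = 0 := by
    rw [im_sum]
    exact Finset.sum_eq_zero fun i _ =>
      im_mul_eq_zero (im_mul_eq_zero hJ (letter_im false)) hL _
  rw [add_re, mul_re, hreal]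
  simp [hc, mul_assoc]

end WordSeries

end Asymptotics

section ZetaSums

open ENNReal

/-- The Taylor coefficients at the origin of the multiple polylogarithm attached to a word ending in
`true`, up to sign. -/
noncomputable def polylogCoeff : List Bool → ℕ → ℝ
  | [], n => if n = 0 then 1 else 0
  | false :: l, n => polylogCoeff l n / n
  | true :: l, n => (∑ m ∈ Finset.range n, polylogCoeff l m) / n

lemma polylogCoeff_nonneg (l : List Bool) (n : ℕ) : 0 ≤ polylogCoeff l n := by
  induction l generalizing n with
  | nil => unfold polylogCoeff; split_ifs <;> norm_num
  | cons a l ih =>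
    cases a
    · exact div_nonneg (ih n) n.cast_nonneg
    · exact div_nonneg (Finset.sum_nonneg fun m _ => ih m) n.cast_nonneg

lemma polylogCoeff_zero {l : List Bool} (h : l ≠ []) : polylogCoeff l 0 = 0 := by
  rcases l with _ | ⟨_ | _, l⟩
  · exact absurd rfl h
  · simp [polylogCoeff]
  · simp [polylogCoeff]

lemma polylogCoeff_replicate_append (k : ℕ) (l : List Bool) (n : ℕ) :
    polylogCoeff (List.replicate k false ++ l) n = ((n : ℝ) ^ k)⁻¹ * polylogCoeff l n := by
  induction k with
  | zero => simp
  | succ k ih =>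
    rw [List.replicate_succ, List.cons_append, polylogCoeff, ih, pow_succ, mul_inv]
    ring

/-- The word encoding a multiple zeta value. -/
def indexWord (s : List ℕ) : List Bool :=
  s.flatMap fun k => true :: List.replicate (k - 1) false

lemma indexWord_cons (k : ℕ) (s : List ℕ) :
    indexWord (k :: s) = true :: List.replicate (k - 1) false ++ indexWord s := by
  simp [indexWord]

lemma indexWord_append (s t : List ℕ) : indexWord (s ++ t) = indexWord s ++ indexWord t := by
  simp [indexWord]

open Classical in
/-- The tail of a multiple zeta value: the sum over strictly increasing tuples all of whose entries
exceed `m`. -/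
noncomputable def zetaTail (s : List ℕ) (m : ℕ) : ℝ≥0∞ :=
  ∑' f : Fin s.length → ℕ+, if StrictMono f ∧ ∀ i, m < f i then
    ∏ i : Fin s.length, ENNReal.ofReal (((f i : ℕ) : ℝ) ^ (s.get i))⁻¹ else 0

lemma MZV_eq_toReal (s : List ℕ) : MZV s = (zetaTail s 0).toReal := by
  classical
  have h : zetaTail s 0 = ∑' f : { f : Fin s.length → ℕ+ // StrictMono f },
      ∏ i : Fin s.length, ENNReal.ofReal (((f.1 i : ℕ) : ℝ) ^ (s.get i))⁻¹ := by
    have := tsum_subtype {f : Fin s.length → ℕ+ | StrictMono f}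
      (fun f => ∏ i : Fin s.length, ENNReal.ofReal (((f i : ℕ) : ℝ) ^ (s.get i))⁻¹)
    refine Eq.trans ?_ this.symm
    unfold zetaTail
    refine tsum_congr fun f => ?_
    simp [Set.indicator_apply]
  rw [h, ENNReal.tsum_toReal_eq fun f => ENNReal.prod_ne_top fun i _ => ENNReal.ofReal_ne_top]
  unfold MZV
  refine tsum_congr fun f => ?_
  rw [ENNReal.toReal_prod]
  refine Finset.prod_congr rfl fun i _ => ?_
  rw [ENNReal.toReal_ofReal (by positivity)]

lemma zetaTail_nil (m : ℕ) : zetaTail [] m = 1 := by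
  unfold zetaTail
  rw [tsum_eq_single (fun i => i.elim0) fun f hf => absurd (funext fun i => i.elim0) hf]
  rw [if_pos ⟨fun i => i.elim0, fun i => i.elim0⟩]
  rfl

lemma strictMono_cons_iff {k : ℕ} (a : ℕ+) (f : Fin k → ℕ+) (m : ℕ) :
    (StrictMono (Fin.cons a f : Fin (k + 1) → ℕ+) ∧
      ∀ i, m < (Fin.cons a f : Fin (k + 1) → ℕ+) i) ↔
      m < a ∧ StrictMono f ∧ ∀ i, (a : ℕ) < f i := by
  constructor
  · rintro ⟨h, hm⟩
    refine ⟨hm 0, fun i j hij => ?_, fun i => ?_⟩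
    · simpa using h (Fin.succ_lt_succ_iff.2 hij)
    · simpa using h (Fin.succ_pos i)
  · rintro ⟨hm, h, ha⟩
    refine ⟨fun i j hij => ?_, fun i => ?_⟩
    · induction j using Fin.cases with
      | zero => simp at hij
      | succ j =>
        induction i using Fin.cases with
        | zero => simpa using ha j
        | succ i => simpa using h (Fin.succ_lt_succ_iff.1 hij)
    · induction i using Fin.cases with
      | zero => simpa using hm
      | succ i => simpa using hm.trans (ha i)

lemma zetaTail_cons (k : ℕ) (s : List ℕ) (m : ℕ) :
    zetaTail (k :: s) m =
      ∑' n : ℕ, if m < n then ENNReal.ofReal ((n : ℝ) ^ k)⁻¹ * zetaTail s n else 0 := by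
  classical
  have h1 : zetaTail (k :: s) m = ∑' n : ℕ+, if m < (n : ℕ) then
      ENNReal.ofReal (((n : ℕ) : ℝ) ^ k)⁻¹ * zetaTail s n else 0 := by
    unfold zetaTail
    refine ((Fin.consEquiv fun _ : Fin (s.length + 1) => ℕ+).tsum_eq _).symm.trans ?_
    rw [ENNReal.tsum_prod']
    refine tsum_congr fun n => ?_
    have : ∀ f : Fin s.length → ℕ+,
        (Fin.consEquiv fun _ : Fin (s.length + 1) => ℕ+) (n, f) =
          (Fin.cons n f : Fin (s.length + 1) → ℕ+) := fun _ => rfl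
    by_cases hn : m < n
    · rw [if_pos hn, ← ENNReal.tsum_mul_left]
      refine tsum_congr fun f => ?_
      rw [this]
      have e := strictMono_cons_iff n f m
      simp only [hn, true_and] at e
      by_cases hf : StrictMono f ∧ ∀ i, (n : ℕ) < f i
      · rw [if_pos hf]
        refine (if_pos (e.2 hf)).trans ?_
        exact Fin.prod_univ_succ _
      · rw [if_neg hf, mul_zero]
        exact if_neg (mt e.1 hf)
    · rw [if_neg hn]
      refine ENNReal.tsum_eq_zero.2 fun f => ?_
      rw [this]
      exact if_neg fun h => hn ((strictMono_cons_iff n f m).1 h).1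
  rw [h1]
  refine PNat.coe_injective.tsum_eq
    (f := fun n : ℕ => if m < n then ENNReal.ofReal ((n : ℝ) ^ k)⁻¹ * zetaTail s n else 0) ?_
  intro n hn
  have : m < n := by
    by_contra h
    simp [h] at hn
  exact ⟨⟨n, by omega⟩, rfl⟩

lemma tsum_polylogCoeff_mul_zetaTail (w : List Bool) (s : List ℕ) (hs : ∀ k ∈ s, 1 ≤ k) :
    ∑' n, ENNReal.ofReal (polylogCoeff w n) * zetaTail s n =
      ∑' n, ENNReal.ofReal (polylogCoeff ((indexWord s).reverse ++ w) n) := by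
  induction s generalizing w with
  | nil => simp [zetaTail_nil, indexWord]
  | cons k s ih =>
    have hk : 1 ≤ k := hs k (by simp)
    have e : (indexWord (k :: s)).reverse ++ w =
        (indexWord s).reverse ++ (List.replicate (k - 1) false ++ true :: w) := by
      simp [indexWord_cons]
    rw [e, ← ih _ fun j hj => hs j (by simp [hj])]
    simp only [zetaTail_cons, ← ENNReal.tsum_mul_left]
    rw [ENNReal.tsum_comm]
    refine tsum_congr fun n => ?_
    have e2 : polylogCoeff (List.replicate (k - 1) false ++ true :: w) n =
        ((n : ℝ) ^ k)⁻¹ * ∑ m ∈ Finset.range n, polylogCoeff w m := by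
      rw [polylogCoeff_replicate_append, polylogCoeff]
      obtain ⟨j, rfl⟩ : ∃ j, k = j + 1 := ⟨k - 1, by omega⟩
      rw [Nat.add_sub_cancel, pow_succ, mul_inv]
      ring
    rw [e2, ENNReal.ofReal_mul (by positivity),
      ENNReal.ofReal_sum_of_nonneg fun m _ => polylogCoeff_nonneg w m,
      tsum_eq_sum (s := Finset.range n) fun m hm => by
        rw [if_neg (by simpa using hm), mul_zero]]
    rw [Finset.mul_sum, Finset.sum_mul]
    refine Finset.sum_congr rfl fun m hm => ?_
    rw [if_pos (by simpa using hm)]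
    ring

lemma MZV_eq_tsum_polylogCoeff (s : List ℕ) (hs : ∀ k ∈ s, 1 ≤ k) :
    MZV s = ∑' n, polylogCoeff (indexWord s).reverse n := by
  have h := tsum_polylogCoeff_mul_zetaTail [] s hs
  rw [tsum_eq_single 0 fun n hn => by simp [polylogCoeff, hn], List.append_nil] at h
  rw [MZV_eq_toReal]
  have h1 : ENNReal.ofReal (polylogCoeff [] 0) = 1 := by simp [polylogCoeff]
  rw [h1, one_mul] at h
  rw [h, ENNReal.tsum_toReal_eq fun _ => ENNReal.ofReal_ne_top]
  exact tsum_congr fun n => ENNReal.toReal_ofReal (polylogCoeff_nonneg _ _)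

end ZetaSums

section PowerSeries

open Set Filter Topology

lemma polylogCoeff_le_one (l : List Bool) (n : ℕ) : polylogCoeff l n ≤ 1 := by
  induction l generalizing n with
  | nil => unfold polylogCoeff; split_ifs <;> norm_num
  | cons a l ih =>
    rcases n.eq_zero_or_pos with rfl | hn
    · rw [polylogCoeff_zero (by simp)]; norm_num
    have hn1 : (1 : ℝ) ≤ n := by exact_mod_cast hn
    cases a
    · exact (div_le_self (polylogCoeff_nonneg l n) hn1).trans (ih n)
    · refine (div_le_one (by linarith)).2 ((Finset.sum_le_sum fun m _ => ih m).trans ?_)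
      simp

lemma tendsto_polylogCoeff (l : List Bool) : Tendsto (polylogCoeff l) atTop (𝓝 0) := by
  induction l with
  | nil =>
    refine tendsto_const_nhds.congr' ?_
    filter_upwards [eventually_gt_atTop 0] with n hn
    simp [polylogCoeff, hn.ne']
  | cons a l ih =>
    cases a
    · simpa [polylogCoeff, div_eq_mul_inv] using! ih.mul tendsto_inv_atTop_nhds_zero_nat
    · simpa [polylogCoeff, div_eq_inv_mul] using! ih.cesaro

lemma norm_polylogCoeff_le (l : List Bool) (n : ℕ) : ‖polylogCoeff l n‖ ≤ 1 := by
  rw [Real.norm_of_nonneg (polylogCoeff_nonneg l n)]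
  exact polylogCoeff_le_one l n

/-- The multiple polylogarithm attached to a word ending in `true`, up to sign. -/
noncomputable def polylogSum (l : List Bool) (x : ℝ) : ℝ := ∑' n, polylogCoeff l n * x ^ n

lemma norm_polylogCoeff_mul_pow_le (l : List Bool) (x : ℝ) (n : ℕ) :
    ‖polylogCoeff l n * x ^ n‖ ≤ ‖x‖ ^ n := by
  rw [norm_mul, norm_pow]
  exact mul_le_of_le_one_left (by positivity) (norm_polylogCoeff_le l n)

lemma summable_norm_polylogSum (l : List Bool) {x : ℝ} (hx : ‖x‖ < 1) :
    Summable fun n => ‖polylogCoeff l n * x ^ n‖ :=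
  (summable_geometric_of_lt_one (norm_nonneg x) hx).of_nonneg_of_le (fun _ => norm_nonneg _)
    (norm_polylogCoeff_mul_pow_le l x)

lemma summable_polylogSum (l : List Bool) {x : ℝ} (hx : ‖x‖ < 1) :
    Summable fun n => polylogCoeff l n * x ^ n := (summable_norm_polylogSum l hx).of_norm

lemma polylogSum_zero (l : List Bool) : polylogSum l 0 = polylogCoeff l 0 := by
  rw [polylogSum, tsum_eq_single 0 fun n hn => by simp [hn]]
  simp

lemma hasDerivAt_polylogSum (l : List Bool) {x : ℝ} (hx : ‖x‖ < 1) :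
    HasDerivAt (polylogSum l) (∑' n : ℕ, polylogCoeff l n * (n * x ^ (n - 1))) x := by
  obtain ⟨r, hxr, hr⟩ := exists_between hx
  have hr0 : 0 < r := (norm_nonneg x).trans_lt hxr
  have hu : Summable fun n : ℕ => (n : ℝ) * r ^ (n - 1) := by
    have := (summable_pow_mul_geometric_of_norm_lt_one 1 (r := r)
      (by rwa [Real.norm_of_nonneg hr0.le])).mul_right r⁻¹
    refine this.congr fun n => ?_
    rcases n with _ | n
    · simp
    · rw [Nat.add_sub_cancel, pow_one, pow_succ]
      field_simp
  refine hasDerivAt_tsum_of_isPreconnected (y₀ := (0 : ℝ)) (t := Metric.ball (0 : ℝ) r) hu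
    Metric.isOpen_ball (convex_ball (0 : ℝ) r).isPreconnected
    (fun n y _ => (hasDerivAt_pow n y).const_mul _)
    (fun n y hy => ?_) (Metric.mem_ball_self hr0) ?_ (by simpa using hxr)
  · rw [mem_ball_zero_iff] at hy
    rw [norm_mul, norm_mul, norm_pow]
    refine (mul_le_of_le_one_left (by positivity) (norm_polylogCoeff_le l n)).trans ?_
    rw [RCLike.norm_natCast]
    gcongr
  · exact summable_polylogSum l (by simp)

lemma tsum_polylogCoeff_cons (a : Bool) (l : List Bool) {x : ℝ} (hx0 : x ≠ 0) (hx : ‖x‖ < 1) :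
    ∑' n : ℕ, polylogCoeff (a :: l) n * (n * x ^ (n - 1)) =
      if a then (1 - x)⁻¹ * polylogSum l x else x⁻¹ * (polylogSum l x - polylogCoeff l 0) := by
  have h0 : ∀ f : ℕ → ℝ, f 0 = 0 → ∑' n, f n = ∑' n, f (n + 1) := by
    intro f hf
    refine (Function.Injective.tsum_eq (add_left_injective 1) fun n hn => ?_).symm
    rcases n with _ | n
    · exact absurd hf hn
    · exact ⟨n, rfl⟩
  rw [h0 _ (by simp)]
  cases a
  · simp only [Bool.false_eq_true, if_false]
    rw [polylogSum, (summable_polylogSum l hx).tsum_eq_zero_add, pow_zero, mul_one,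
      add_sub_cancel_left, ← tsum_mul_left]
    refine tsum_congr fun n => ?_
    have : ((n : ℝ) + 1) ≠ 0 := by positivity
    rw [polylogCoeff, Nat.add_sub_cancel]
    push_cast
    field_simp
    ring
  · simp only [if_true]
    rw [← tsum_geometric_of_norm_lt_one hx, mul_comm, polylogSum,
      tsum_mul_tsum_eq_tsum_sum_range_of_summable_norm (summable_norm_polylogSum l hx)
        (by simpa using summable_geometric_of_lt_one (norm_nonneg x) hx)]
    refine tsum_congr fun n => ?_
    have : ((n : ℝ) + 1) ≠ 0 := by positivity
    rw [polylogCoeff, Nat.add_sub_cancel]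
    have e : ∀ m ∈ Finset.range (n + 1), polylogCoeff l m * x ^ m * x ^ (n - m) =
        polylogCoeff l m * x ^ n := by
      intro m hm
      rw [Finset.mem_range] at hm
      rw [mul_assoc, ← pow_add]
      congr 2; omega
    rw [Finset.sum_congr rfl e, ← Finset.sum_mul]
    push_cast
    field_simp

lemma polylog_eq_polylogSum (l : List Bool) (hl : ∀ h : l ≠ [], l.getLast h = true) {x : ℝ}
    (hx : x ∈ Ico (0 : ℝ) 1) :
    polylog l x = (-1) ^ l.count true * (polylogSum l x : ℂ) := by
  induction l generalizing x with
  | nil =>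
    have : polylogSum [] x = 1 := by
      rw [polylogSum, tsum_eq_single 0 fun n hn => by simp [polylogCoeff, hn]]
      simp [polylogCoeff]
    simp [polylog_nil, this]
  | cons a l ih =>
    have hlast := hl (by simp)
    have hl' : ∀ h : l ≠ [], l.getLast h = true := fun h => by
      rwa [List.getLast_cons h] at hlast
    rcases hx.1.eq_or_lt with rfl | hx0
    · simp [polylog_zero, polylogSum_zero, polylogCoeff_zero]
    have hmem : ∀ t ∈ Icc 0 x, (t : ℂ) ∈ leftHalf := fun t ht => by
      show (t : ℂ).re < 1
      rw [Complex.ofReal_re]; exact ht.2.trans_lt hx.2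
    have hnorm : ∀ t ∈ Icc 0 x, ‖t‖ < 1 := fun t ht => by
      rw [Real.norm_of_nonneg ht.1]; exact ht.2.trans_lt hx.2
    set g : ℝ → ℂ := fun t =>
      polylog (a :: l) t - (-1) ^ (a :: l).count true * (polylogSum (a :: l) t : ℂ) with hg
    have hd : ∀ t ∈ Icc 0 x, HasDerivAt g
        (polylogDeriv a ((a :: l).getLast (List.cons_ne_nil a l))
            (polylog l) (polylog (a :: l).dropLast) t - (-1) ^ (a :: l).count true *
          ((∑' n : ℕ, polylogCoeff (a :: l) n * (n * t ^ (n - 1)) : ℝ) : ℂ)) t := fun t ht =>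
      ((hasDerivAt_polylog_cons a l (hmem t ht)).comp_ofReal).sub
        ((hasDerivAt_polylogSum (a :: l) (hnorm t ht)).ofReal_comp.const_mul _)
    have h := WordSeries.eq_of_hasDerivAt_zero hx0
      (fun t ht => (hd t ht).continuousAt.continuousWithinAt) fun t ht => by
        have ht' : t ∈ Icc 0 x := ⟨ht.1.le, ht.2.le⟩
        refine (hd t ht').congr_deriv ?_
        have htc : (t : ℂ) ≠ 0 := by exact_mod_cast ht.1.ne'
        rw [polylogDeriv_eq a l htc, hlast, if_pos rfl, sub_zero,
          tsum_polylogCoeff_cons a l ht.1.ne' (hnorm t ht'), ih hl' ⟨ht.1.le, ht.2.trans hx.2⟩]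
        cases a
        · have : l ≠ [] := by rintro rfl; simp at hlast
          simp [form, polylogCoeff_zero this]
          ring
        · have e : ((t : ℂ) - 1)⁻¹ = -(1 - (t : ℂ))⁻¹ := by rw [← inv_neg]; ring
          simp [form, e, pow_succ]
          ring
    have h0 : g 0 = 0 := by simp [hg, polylog_zero, polylogSum_zero, polylogCoeff_zero]
    rw [h0] at h
    exact sub_eq_zero.1 h

lemma tendsto_one_sub_mul_tsum {a : ℕ → ℝ} (ha : Tendsto a atTop (𝓝 0))
    (hs : ∀ x : ℝ, ‖x‖ < 1 → Summable fun n => a n * x ^ n) :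
    Tendsto (fun x : ℝ => (1 - x) * ∑' n, a n * x ^ n) (𝓝[<] 1) (𝓝 0) := by
  set f : ℕ → ℝ := fun n => n.casesOn (a 0) fun m => a (m + 1) - a m with hf
  have hsum : ∀ n, ∑ i ∈ Finset.range (n + 1), f i = a n := by
    intro n
    induction n with
    | zero => simp [hf]
    | succ n ih => rw [Finset.sum_range_succ, ih]; simp [hf]
  have h := Real.tendsto_tsum_powerSeries_nhdsWithin_lt (f := f) (l := 0)
    ((tendsto_add_atTop_iff_nat 1).1 (by simpa only [hsum] using ha))
  refine h.congr' ?_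
  have : Ioo (0 : ℝ) 1 ∈ 𝓝[<] (1 : ℝ) := Ioo_mem_nhdsLT one_pos
  filter_upwards [this] with x hx
  have hx1 : ‖x‖ < 1 := by rw [Real.norm_of_nonneg hx.1.le]; exact hx.2
  have s := hs x hx1
  have s1 : Summable fun n => a (n + 1) * x ^ (n + 1) := (summable_nat_add_iff 1).2 s
  have s2 : Summable fun n => x * (a n * x ^ n) := s.mul_left x
  have e : ∀ n, f (n + 1) * x ^ (n + 1) = a (n + 1) * x ^ (n + 1) - x * (a n * x ^ n) := by
    intro n; simp only [hf]; ring
  have sf : Summable fun n => f n * x ^ n :=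
    (summable_nat_add_iff 1).1 (by simpa only [e] using s1.sub s2)
  rw [sf.tsum_eq_zero_add]
  simp only [e]
  rw [s1.tsum_sub s2, tsum_mul_left, sub_mul, one_mul]
  rw [s.tsum_eq_zero_add]
  have hf0 : f 0 = a 0 := rfl
  rw [hf0]
  ring

lemma tsum_eq_of_tendsto_powerSeries {c : ℕ → ℝ} {A : ℝ} (hc : ∀ n, 0 ≤ c n)
    (hs : ∀ x : ℝ, ‖x‖ < 1 → Summable fun n => c n * x ^ n)
    (h : Tendsto (fun x : ℝ => ∑' n, c n * x ^ n) (𝓝[<] 1) (𝓝 A)) : ∑' n, c n = A := by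
  have hmem : Ioo (0 : ℝ) 1 ∈ 𝓝[<] (1 : ℝ) := Ioo_mem_nhdsLT one_pos
  have hbound : ∀ n, ∑ i ∈ Finset.range n, c i ≤ A := by
    intro n
    have h1 : Tendsto (fun x : ℝ => ∑ i ∈ Finset.range n, c i * x ^ i) (𝓝[<] 1)
        (𝓝 (∑ i ∈ Finset.range n, c i * 1 ^ i)) :=
      (Continuous.tendsto (by fun_prop) 1).mono_left nhdsWithin_le_nhds
    simp only [one_pow, mul_one] at h1
    refine le_of_tendsto_of_tendsto h1 h ?_
    filter_upwards [hmem] with x hx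
    have hx1 : ‖x‖ < 1 := by rw [Real.norm_of_nonneg hx.1.le]; exact hx.2
    exact (hs x hx1).sum_le_tsum _ fun i _ => mul_nonneg (hc i) (pow_nonneg hx.1.le i)
  have hsum : Summable c := summable_of_sum_range_le hc hbound
  exact tendsto_nhds_unique
    (Real.tendsto_tsum_powerSeries_nhdsWithin_lt hsum.hasSum.tendsto_sum_nat) h

lemma polylogSum_le {l : List Bool} (hl : l ≠ []) {x : ℝ} (hx : x ∈ Ico (0 : ℝ) 1) :
    ‖polylogSum l x‖ ≤ x / (1 - x) := by
  have hx1 : ‖x‖ < 1 := by rw [Real.norm_of_nonneg hx.1]; exact hx.2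
  rw [polylogSum, (summable_polylogSum l hx1).tsum_eq_zero_add, polylogCoeff_zero hl, zero_mul,
    zero_add]
  have hg : HasSum (fun n => x ^ (n + 1)) (x / (1 - x)) := by
    have := (hasSum_geometric_of_lt_one hx.1 hx.2).mul_left x
    simpa [pow_succ', div_eq_mul_inv] using this
  refine tsum_of_norm_bounded hg fun n => ?_
  have := norm_polylogCoeff_mul_pow_le l x (n + 1)
  rwa [Real.norm_of_nonneg hx.1] at this

end PowerSeries

section Duality

open Set Filter Topology

namespace WordSeries

lemma swap_mul (f g : WordSeries) : swap (f * g) = swap f * swap g := by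
  ext l
  simp only [swap_apply, mul_apply_eq_sum, List.length_map, List.map_take, List.map_drop]

lemma swap_letter_false : swap (letter false) = letter true := by
  ext l
  rcases l with _ | ⟨_ | _, _ | ⟨b, l⟩⟩ <;> simp [letter]

/-- The duality combination, whose value at a convergent word is a multiple zeta value. -/
noncomputable def dualPair (x : ℝ) : WordSeries := plog (1 - x) * swap (plogInv x)

lemma hasDeriv_dualPair {x : ℝ} (hx : x ∈ Ioo (0 : ℝ) 1) :
    HasDeriv dualPair ((1 - x : ℂ)⁻¹ • (letter false * dualPair x) +
      (x : ℂ)⁻¹ • (dualPair x * letter true)) x := by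
  have hx0 : (x : ℂ) ≠ 0 := by exact_mod_cast hx.1.ne'
  have hx1 : (1 - x : ℂ) ≠ 0 := by
    rw [sub_ne_zero]; exact_mod_cast hx.2.ne'
  have h1 : HasDerivAt (fun s : ℝ => (1 - s : ℂ)) (-1) x :=
    (hasDerivAt_id x).ofReal_comp.const_sub 1
  have h2 : HasDerivAt (fun s : ℝ => (s : ℂ)) 1 x := (hasDerivAt_id x).ofReal_comp
  have hL := hasDeriv_plog h1 (by simp [leftHalf, hx.1]) hx1
  have hJ := hasDeriv_plogInv h2 (by simp [leftHalf, hx.2]) hx0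
  have hJ' : HasDeriv (fun s : ℝ => swap (plogInv s))
      (swap ((1 : ℂ) • ((x : ℂ)⁻¹ • (plogInv x * letter false) - conn x * plogInv x))) x :=
    fun l => hJ (l.map not)
  have h := hL.mul hJ'
  have e : swap ((1 : ℂ) • ((x : ℂ)⁻¹ • (plogInv x * letter false) - conn x * plogInv x)) =
      (x : ℂ)⁻¹ • (swap (plogInv x) * letter true) - swap (conn x) * swap (plogInv x) := by
    rw [one_smul, ← swap_letter_false, ← swap_mul, ← swap_mul]
    rfl
  rw [e, conn_one_sub] at h
  convert! h using 1
  simp only [dualPair, neg_smul, one_smul, mul_neg, neg_mul, mul_sub, sub_mul, mul_assoc,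
    smul_mul_assoc, mul_smul_comm, neg_sub]
  abel

/-- A word whose iterated integral over the unit interval converges. -/
def Admissible (X : List Bool) : Prop := X.head? ≠ some false ∧ X.getLast? ≠ some true

lemma dualPair_apply_eq {X : List Bool} (hX : Admissible X) {x y : ℝ}
    (hx : x ∈ Ioo (0 : ℝ) 1) (hy : y ∈ Ioo (0 : ℝ) 1) : dualPair x X = dualPair y X := by
  have hd : ∀ t ∈ Ioo (0 : ℝ) 1, HasDerivAt (fun s => dualPair s X) 0 t := by
    intro t ht
    refine (hasDeriv_dualPair ht X).congr_deriv ?_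
    rw [add_apply, smul_apply, smul_apply]
    have h1 : (letter false * dualPair t) X = 0 := by
      rcases X with _ | ⟨_ | _, X⟩
      · simp
      · exact absurd rfl hX.1
      · simp [letter_mul_cons]
    have h2 : (dualPair t * letter true) X = 0 := by
      rcases List.eq_nil_or_concat' X with rfl | ⟨X, _ | _, rfl⟩
      · simp
      · simp [mul_letter_concat]
      · exact absurd (by simp) hX.2
    rw [h1, h2, mul_zero, mul_zero, add_zero]
  exact isOpen_Ioo.is_const_of_deriv_eq_zero isPreconnected_Ioo
    (fun t ht => (hd t ht).differentiableAt.differentiableWithinAt)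
    (fun t ht => (hd t ht).deriv) hx hy

lemma tendsto_polylog_mul_polylog {u v : List Bool} (hu : ∀ h : u ≠ [], u.getLast h = true)
    (hv : ∀ h : v ≠ [], v.getLast h = true) (hv0 : v ≠ []) :
    Tendsto (fun t : ℝ => polylog u t * polylog v (1 - t)) (𝓝[<] 1) (𝓝 0) := by
  have h1 : Tendsto (fun t : ℝ => ‖(1 - t) * polylogSum u t‖ * t⁻¹) (𝓝[<] 1) (𝓝 0) := by
    have h := (tendsto_one_sub_mul_tsum (tendsto_polylogCoeff u)
      fun x hx => summable_polylogSum u hx).norm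
    have h2 : Tendsto (fun t : ℝ => t⁻¹) (𝓝[<] 1) (𝓝 1⁻¹) :=
      (tendsto_inv₀ one_ne_zero).mono_left nhdsWithin_le_nhds
    simpa using! h.mul h2
  refine squeeze_zero_norm' ?_ h1
  have hmem : Ioo (0 : ℝ) 1 ∈ 𝓝[<] (1 : ℝ) := Ioo_mem_nhdsLT one_pos
  filter_upwards [hmem] with t ht
  have ht' : 1 - t ∈ Ico (0 : ℝ) 1 := ⟨by linarith [ht.2], by linarith [ht.1]⟩
  have hb := polylogSum_le hv0 ht'
  have e : (1 - t : ℂ) = ((1 - t : ℝ) : ℂ) := by push_cast; rfl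
  rw [e, polylog_eq_polylogSum u hu ⟨ht.1.le, ht.2⟩, polylog_eq_polylogSum v hv ht']
  simp only [norm_mul, norm_pow, norm_neg, norm_one, one_pow, one_mul, Complex.norm_real]
  rw [sub_sub_cancel] at hb
  calc ‖polylogSum u t‖ * ‖polylogSum v (1 - t)‖
      ≤ ‖polylogSum u t‖ * ((1 - t) / t) := by gcongr
    _ = ‖1 - t‖ * ‖polylogSum u t‖ * t⁻¹ := by
      rw [Real.norm_of_nonneg ht'.1]; ring

lemma tendsto_dualPair {X : List Bool} (hX : Admissible X) :
    Tendsto (fun t : ℝ => dualPair (1 - t) X - (-1) ^ X.count true * (polylogSum X.reverse t : ℂ))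
      (𝓝[<] 1) (𝓝 0) := by
  have hu : ∀ m, ∀ h : (X.take m).reverse ≠ [], (X.take m).reverse.getLast h = true := by
    intro m h
    rcases X with _ | ⟨_ | _, X⟩
    · simp at h
    · exact absurd rfl hX.1
    · rcases m with _ | m
      · simp at h
      · simp
  have hv : ∀ m, ∀ h : (X.drop m).map not ≠ [], ((X.drop m).map not).getLast h = true := by
    intro m h
    have h0 : X.drop m ≠ [] := by simpa using h
    have h1 : X.drop m <:+ X := List.drop_suffix m X
    have h2 : (X.drop m).getLast h0 = X.getLast (h1.ne_nil h0) := h1.getLast h0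
    rw [List.getLast_map, h2]
    by_contra h3
    refine hX.2 ?_
    rw [List.getLast?_eq_some_getLast (h1.ne_nil h0)]
    simpa using h3
  have key : Tendsto (fun t : ℝ => ∑ m ∈ Finset.range X.length,
      polylog (X.take m).reverse t * ((-1) ^ ((X.drop m).map not).length *
        polylog ((X.drop m).map not) (1 - t))) (𝓝[<] 1) (𝓝 (∑ m ∈ Finset.range X.length, 0)) := by
    refine tendsto_finsetSum _ fun m hm => ?_
    have hne : (X.drop m).map not ≠ [] := by
      simpa using Finset.mem_range.1 hm
    have := (tendsto_polylog_mul_polylog (hu m) (hv m) hne).const_mul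
      ((-1 : ℂ) ^ ((X.drop m).map not).length)
    rw [mul_zero] at this
    refine this.congr fun t => ?_
    ring
  rw [Finset.sum_const_zero] at key
  refine key.congr' ?_
  have hmem : Ioo (0 : ℝ) 1 ∈ 𝓝[<] (1 : ℝ) := Ioo_mem_nhdsLT one_pos
  filter_upwards [hmem] with t ht
  have hr := polylog_eq_polylogSum X.reverse (by simpa using hu X.length) ⟨ht.1.le, ht.2⟩
  rw [List.count_reverse] at hr
  rw [← hr, dualPair, mul_apply_eq_sum, Finset.sum_range_succ]
  simp [plog, plogInv, polylog_nil]

lemma re_dualPair_indexWord {s : List ℕ} (hs : ∀ k ∈ s, 1 ≤ k)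
    (hX : Admissible (indexWord s)) {x : ℝ} (hx : x ∈ Ioo (0 : ℝ) 1) :
    (dualPair x (indexWord s)).re = (-1) ^ (indexWord s).count true * MZV s := by
  rw [MZV_eq_tsum_polylogCoeff s hs]
  set X := indexWord s
  set A := (dualPair x X).re with hA
  have hmem : Ioo (0 : ℝ) 1 ∈ 𝓝[<] (1 : ℝ) := Ioo_mem_nhdsLT one_pos
  have hsq : ((-1 : ℝ) ^ X.count true) * (-1) ^ X.count true = 1 := by
    rw [← mul_pow]; norm_num
  have h : Tendsto (fun t : ℝ => ∑' n, polylogCoeff X.reverse n * t ^ n) (𝓝[<] 1)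
      (𝓝 ((-1) ^ X.count true * A)) := by
    have h1 := (Complex.continuous_re.tendsto 0).comp (tendsto_dualPair hX)
    have h2 := (h1.const_sub A).const_mul ((-1 : ℝ) ^ X.count true)
    rw [Complex.zero_re, sub_zero] at h2
    refine h2.congr' ?_
    filter_upwards [hmem] with t ht
    have ht' : 1 - t ∈ Ioo (0 : ℝ) 1 := ⟨by linarith [ht.2], by linarith [ht.1]⟩
    have e : ((-1 : ℂ) ^ X.count true * (polylogSum X.reverse t : ℂ)).re =
        (-1) ^ X.count true * polylogSum X.reverse t := by
      rw [← Complex.ofReal_re ((-1) ^ X.count true * polylogSum X.reverse t)]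
      push_cast; rfl
    rw [Function.comp_apply, dualPair_apply_eq hX ht' hx, Complex.sub_re, e, ← hA, sub_sub_cancel,
      ← mul_assoc, hsq, one_mul]
    rfl
  rw [tsum_eq_of_tendsto_powerSeries (polylogCoeff_nonneg _)
    (fun x hx => summable_polylogSum _ hx) h, ← mul_assoc, hsq, one_mul]

end WordSeries

end Duality

section Blocks

open WordSeries

/-- The alternating word with first letter `c` and length `2 * b + 2`. -/
def altBlock (c : Bool) : ℕ → List Bool
  | 0 => [c, !c]
  | b + 1 => c :: (!c) :: altBlock c b

/-- The concatenation of alternating words in which the last letter of each word is repeated by the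
next one. -/
def blockWord : Bool → List ℕ → List Bool
  | _, [] => []
  | c, b :: bs => altBlock c b ++ blockWord (!c) bs

lemma length_altBlock (c : Bool) (b : ℕ) : (altBlock c b).length = 2 * b + 2 := by
  induction b with
  | zero => rfl
  | succ b ih => rw [altBlock, List.length_cons, List.length_cons, ih]; ring

lemma count_altBlock (c : Bool) (b : ℕ) : (altBlock c b).count true = b + 1 := by
  induction b with
  | zero => cases c <;> rfl
  | succ b ih => cases c <;> simp [altBlock, ih]

lemma length_blockWord (c : Bool) (bs : List ℕ) :
    (blockWord c bs).length = 2 * (bs.map (· + 1)).sum := by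
  induction bs generalizing c with
  | nil => rfl
  | cons b bs ih =>
    rw [blockWord, List.length_append, ih, length_altBlock, List.map_cons, List.sum_cons]
    ring

lemma count_blockWord (c : Bool) (bs : List ℕ) :
    (blockWord c bs).count true = (bs.map (· + 1)).sum := by
  induction bs generalizing c with
  | nil => rfl
  | cons b bs ih =>
    rw [blockWord, List.count_append, ih, count_altBlock, List.map_cons, List.sum_cons]

lemma map_not_altBlock (c : Bool) (b : ℕ) : (altBlock c b).map not = altBlock (!c) b := by
  induction b with
  | zero => rfl
  | succ b ih => simp [altBlock, ih]

lemma blockWord_concat (c : Bool) (bs : List ℕ) (b : ℕ) :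
    blockWord c (bs ++ [b]) = blockWord c bs ++ altBlock (c ^^ bs.length.bodd) b := by
  induction bs generalizing c with
  | nil => simp [blockWord]
  | cons b' bs ih => simp [blockWord, ih, Nat.bodd_succ]

lemma twist_iterate_blockWord_cons (c : Bool) (b : ℕ) (bs : List ℕ)
    (h : (b :: bs).length.bodd = true) :
    twist^[2 * b + 2] (blockWord c (b :: bs)) = blockWord (!c) (bs ++ [b]) := by
  have h' : bs.length.bodd = false := by simpa [Nat.bodd_succ] using h
  rw [blockWord_concat, blockWord, ← length_altBlock c b, twist_iterate_append, map_not_altBlock,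
    h', Bool.xor_false]

lemma altBlock_false (b : ℕ) :
    altBlock false b = false :: (indexWord (List.replicate b 2) ++ [true]) := by
  induction b with
  | zero => rfl
  | succ b ih => simp [altBlock, ih, List.replicate_succ, indexWord_cons]

lemma altBlock_true (b : ℕ) :
    altBlock true b = indexWord (List.replicate b 2) ++ [true, false] := by
  induction b with
  | zero => rfl
  | succ b ih => simp [altBlock, ih, List.replicate_succ, indexWord_cons]

lemma bodd_length_induction {p : List ℕ → Prop} (one : ∀ b, p [b])
    (step : ∀ b c bs, p bs → p (b :: c :: bs)) :
    ∀ bs : List ℕ, bs.length.bodd = true → p bs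
  | [], h => by simp at h
  | [b], _ => one b
  | b :: c :: bs, h => step b c bs
      (bodd_length_induction one step bs (by simpa [Nat.bodd_succ] using h))

lemma blockWord_false {bs : List ℕ} (h : bs.length.bodd = true) :
    blockWord false bs = false :: (indexWord (Zargs bs) ++ [true]) := by
  refine bodd_length_induction
    (p := fun bs => blockWord false bs = false :: (indexWord (Zargs bs) ++ [true]))
    (fun b => ?_) (fun b c bs ih => ?_) bs h
  · simp [blockWord, Zargs, altBlock_false]
  · simp [blockWord, Zargs, altBlock_false, altBlock_true, ih, indexWord]

lemma one_le_of_mem_Zargs {bs : List ℕ} (h : bs.length.bodd = true) :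
    ∀ k ∈ Zargs bs, 1 ≤ k := by
  refine bodd_length_induction (p := fun bs => ∀ k ∈ Zargs bs, 1 ≤ k)
    (fun b => ?_) (fun b c bs ih => ?_) bs h
  · intro k hk
    rw [(List.mem_replicate.1 hk).2]; norm_num
  · intro k hk
    simp only [Zargs, List.mem_append, List.mem_replicate, List.mem_singleton] at hk
    rcases hk with (((hk | hk) | hk) | hk) | hk
    all_goals first | exact ih k hk | omega

lemma admissible_indexWord_Zargs {bs : List ℕ} (h : bs.length.bodd = true) :
    Admissible (indexWord (Zargs bs)) := by
  constructor
  · cases Zargs bs <;> simp [indexWord]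
  · refine bodd_length_induction (p := fun bs => (indexWord (Zargs bs)).getLast? ≠ some true)
      (fun b => ?_) (fun b c bs ih => ?_) bs h
    · cases b with
      | zero => simp [Zargs, indexWord]
      | succ b => simp [Zargs, List.replicate_succ', indexWord]
    · rw [Zargs, indexWord_append, indexWord_append, List.getLast?_append, List.getLast?_append]
      cases hl : (indexWord (Zargs bs)).getLast? with
      | none => simp [indexWord]
      | some d => rwa [hl] at ih

lemma letter_mul_letter_mul_eq_zero (h : WordSeries) (c : Bool) (l : List Bool) :
    (letter false * (letter false * h)) (c :: (!c) :: l) = 0 := by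
  cases c <;> simp [letter_mul_cons]

lemma sum_twist_altBlock (h : WordSeries) (c : Bool) (b : ℕ) (V : List Bool) :
    ∑ i ∈ Finset.range (2 * b + 2), (letter false * (letter false * h))
        (twist^[i] (altBlock c b ++ V)) =
      (letter false * (letter false * h)) (twist^[2 * b + 1] (altBlock c b ++ V)) := by
  induction b generalizing V with
  | zero =>
    rw [Finset.sum_range_succ, Finset.sum_range_one]
    simp only [altBlock, Function.iterate_zero, id, List.cons_append]
    rw [letter_mul_letter_mul_eq_zero, zero_add]
  | succ b ih =>
    obtain ⟨L, hL⟩ : ∃ L, altBlock c b = c :: L := by cases b <;> simp [altBlock]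
    have e2 : twist^[2] (altBlock c (b + 1) ++ V) = altBlock c b ++ (V ++ [!c, c]) := by
      simp [altBlock, twist]
    have e3 : ∀ i, twist^[i + 1 + 1] (altBlock c (b + 1) ++ V) =
        twist^[i] (altBlock c b ++ (V ++ [!c, c])) := fun i => by
      rw [← e2, ← Function.iterate_add_apply]
    rw [show 2 * (b + 1) + 2 = (2 * b + 2) + 1 + 1 by ring, Finset.sum_range_succ',
      Finset.sum_range_succ']
    simp only [e3, ih]
    have z0 : (letter false * (letter false * h)) (twist^[0] (altBlock c (b + 1) ++ V)) = 0 := by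
      simp only [altBlock, Function.iterate_zero, id, List.cons_append]
      exact letter_mul_letter_mul_eq_zero h c _
    have z1 : (letter false * (letter false * h))
        (twist^[0 + 1] (altBlock c (b + 1) ++ V)) = 0 := by
      have := letter_mul_letter_mul_eq_zero h (!c) (L ++ V ++ [!c])
      simpa [altBlock, hL, twist] using this
    rw [z0, z1, add_zero, add_zero, show 2 * (b + 1) + 1 = 2 * b + 1 + 1 + 1 by ring, e3]

lemma eq_cons_of_twist_eq {w l : List Bool} {a : Bool} (h : twist w = l ++ [a]) :
    w = (!a) :: l := by
  cases w with
  | nil => simp [twist] at h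
  | cons b w =>
    obtain ⟨rfl, h2⟩ := List.append_inj' h rfl
    simp only [List.cons.injEq, and_true] at h2
    simp [← h2]

lemma sum_twist_blockWord_cons (h : WordSeries) (c : Bool) (b : ℕ) (bs : List ℕ)
    (hb : (b :: bs).length.bodd = true) :
    ∑ i ∈ Finset.range (2 * b + 2), (letter false * (letter false * h))
        (twist^[i] (blockWord c (b :: bs))) =
      if c then h (indexWord (Zargs (bs ++ [b]))) else 0 := by
  have h1 := twist_iterate_blockWord_cons c b bs hb
  rw [Function.iterate_succ_apply'] at h1
  rw [blockWord, sum_twist_altBlock, ← blockWord]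
  cases c
  · have e : blockWord (!false) (bs ++ [b]) =
        (blockWord true bs ++ indexWord (List.replicate b 2) ++ [true]) ++ [false] := by
      have h' : bs.length.bodd = false := by simpa [Nat.bodd_succ] using hb
      simp [blockWord_concat, h', altBlock_true]
    rw [e] at h1
    rw [eq_cons_of_twist_eq h1]
    simp [letter_mul_cons]
  · rw [Bool.not_true, blockWord_false (by simpa using hb), ← List.cons_append] at h1
    rw [eq_cons_of_twist_eq h1]
    simp [letter_mul_cons]

lemma sum_twist_blockWord_append (h : WordSeries) (c : Bool) (us vs : List ℕ)
    (hb : (us ++ vs).length.bodd = true) :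
    twist^[(blockWord c us).length] (blockWord c (us ++ vs)) =
        blockWord (c ^^ us.length.bodd) (vs ++ us) ∧
      ∑ i ∈ Finset.range (blockWord c us).length, (letter false * (letter false * h))
        (twist^[i] (blockWord c (us ++ vs))) =
      ∑ k ∈ Finset.range us.length,
        if c ^^ k.bodd then h (indexWord (Zargs ((us ++ vs).rotate (k + 1)))) else 0 := by
  induction us generalizing c vs with
  | nil => simp [blockWord]
  | cons u us ih =>
    have hb' : (us ++ (vs ++ [u])).length.bodd = true := by
      rw [← hb]; congr 1; simp; ring
    obtain ⟨ih1, ih2⟩ := ih (!c) (vs ++ [u]) hb'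
    have hlen : (blockWord c (u :: us)).length = (2 * u + 2) + (blockWord (!c) us).length := by
      rw [blockWord, List.length_append, length_altBlock]
    have ht := twist_iterate_blockWord_cons c u (us ++ vs) hb
    rw [List.append_assoc] at ht
    rw [hlen]
    constructor
    · rw [add_comm, Function.iterate_add_apply, List.cons_append, ht, ih1]
      simp [Nat.bodd_succ]
    · rw [Finset.sum_range_add, List.cons_append, sum_twist_blockWord_cons h c u (us ++ vs) hb,
        List.length_cons, Finset.sum_range_succ', add_comm]
      congr 1
      · simp only [add_comm (2 * u + 2), Function.iterate_add_apply _ _ (2 * u + 2), ht, ih2,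
          List.rotate_cons_succ, Nat.bodd_succ, List.append_assoc, Bool.not_xor, Bool.xor_not]
      · simp

lemma sum_twist_blockWord (h : WordSeries) {bs : List ℕ} (hb : bs.length.bodd = true) :
    ∑ i ∈ Finset.range (2 * (blockWord false bs).length), (letter false * (letter false * h))
        (twist^[i] (blockWord false bs)) =
      ∑ k ∈ Finset.range bs.length, h (indexWord (Zargs (bs.rotate (k + 1)))) := by
  obtain ⟨h1, h2⟩ := sum_twist_blockWord_append h false bs [] (by simpa using hb)
  obtain ⟨-, h3⟩ := sum_twist_blockWord_append h true bs [] (by simpa using hb)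
  simp only [List.append_nil, List.nil_append, hb] at h1 h2 h3
  rw [two_mul, Finset.sum_range_add, h2]
  simp only [add_comm (blockWord false bs).length, Function.iterate_add_apply, h1]
  rw [length_blockWord false, ← length_blockWord true]
  rw [show (false ^^ true) = true from rfl, h3, ← Finset.sum_add_distrib]
  refine Finset.sum_congr rfl fun k _ => ?_
  cases k.bodd <;> simp

lemma expTail_mul_apply (c : ℂ) (P : WordSeries) {X : List Bool} (hX : Admissible X) :
    (expTail c * P) X = c ^ 2 / 2 * P X := by
  rw [mul_apply_eq_sum, Finset.sum_eq_single 0]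
  · simp [expTail]
  · intro m hm hm0
    rcases X with _ | ⟨_ | _, X⟩
    · simp_all
    · exact absurd rfl hX.1
    · obtain ⟨m, rfl⟩ := Nat.exists_eq_succ_of_ne_zero hm0
      simp [expTail]
  · simp

/-- The cyclic insertion identity. -/
theorem sum_Z_rotate {bs : List ℕ} (hb : bs.length.bodd = true) :
    ∑ k ∈ Finset.range bs.length, Z (bs.rotate (k + 1)) =
      Real.pi ^ (2 * (bs.map (· + 1)).sum - 2) / (2 * (bs.map (· + 1)).sum - 1).factorial := by
  set M := (bs.map (· + 1)).sum with hM
  have hd : ∀ k, (indexWord (Zargs (bs.rotate (k + 1)))).count true + 1 = M := by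
    intro k
    have h1 : (bs.rotate (k + 1)).length.bodd = true := by simpa using hb
    have h2 := count_blockWord false (bs.rotate (k + 1))
    rw [blockWord_false h1, ((bs.rotate_perm (k + 1)).map (· + 1)).sum_eq, ← hM] at h2
    simpa using h2
  obtain ⟨d, hd'⟩ : ∃ d, M = d + 1 := ⟨_, (hd 0).symm⟩
  have hW : blockWord false bs ≠ [] := by simp [blockWord_false hb]
  have h := re_sum_twist_eq hW
  rw [sum_twist_blockWord _ hb, length_blockWord, ← hM, Complex.re_sum] at h
  have hterm : ∀ k ∈ Finset.range bs.length,
      ((expTail (2 * Real.pi * Complex.I) * (plog (1 / 2) * swap (plogInv (1 / 2))))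
        (indexWord (Zargs (bs.rotate (k + 1))))).re =
      -(2 * Real.pi ^ 2 * (-1) ^ d) * Z (bs.rotate (k + 1)) := by
    intro k _
    have h1 : (bs.rotate (k + 1)).length.bodd = true := by simpa using hb
    have hA := admissible_indexWord_Zargs h1
    have hcount : (indexWord (Zargs (bs.rotate (k + 1)))).count true = d := by
      have := hd k; omega
    have e : plog (1 / 2) * swap (plogInv (1 / 2)) = dualPair (1 / 2) := by
      rw [dualPair]; push_cast; norm_num
    have e2 : (2 * Real.pi * Complex.I) ^ 2 / 2 = ((-(2 * Real.pi ^ 2) : ℝ) : ℂ) := by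
      push_cast
      rw [mul_pow, Complex.I_sq]; ring
    rw [expTail_mul_apply _ _ hA, e, e2, Complex.re_ofReal_mul,
      re_dualPair_indexWord (one_le_of_mem_Zargs h1) hA (by norm_num), hcount, Z]
    ring
  rw [Finset.sum_congr rfl hterm, ← Finset.mul_sum] at h
  have hI : (2 * ((2 * M : ℕ) : ℂ) * ((Real.pi * Complex.I) ^ (2 * M) / (2 * M).factorial)) =
      ((2 * (2 * M : ℕ) * ((-1) ^ M * Real.pi ^ (2 * M) / (2 * M).factorial) : ℝ) : ℂ) := by
    push_cast
    rw [mul_pow, pow_mul Complex.I, Complex.I_sq]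
    ring
  rw [hI, Complex.ofReal_re, hd'] at h
  rw [hd', show 2 * (d + 1) - 2 = 2 * d by omega, show 2 * (d + 1) - 1 = 2 * d + 1 by omega]
  rw [show 2 * (d + 1) = (2 * d + 1) + 1 by ring, Nat.factorial_succ] at h
  have hf : ((2 * d + 1).factorial : ℝ) ≠ 0 := by positivity
  rw [eq_div_iff hf]
  have hpi := Real.pi_ne_zero
  have hd2 : ((2 * d + 1 + 1 : ℕ) : ℝ) ≠ 0 := by positivity
  rw [Nat.cast_mul, pow_succ (-1 : ℝ)] at h
  field_simp at h
  refine mul_left_cancel₀ (pow_ne_zero 2 hpi) ?_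
  linear_combination -h

lemma rotate_ofFn {m : ℕ} [NeZero m] (f : Fin m → ℕ) (k : ℕ) :
    (List.ofFn f).rotate k = List.ofFn (f ∘ Equiv.addRight (Fin.ofNat m k)) := by
  refine List.ext_getElem (by simp) fun i h1 h2 => ?_
  rw [List.getElem_rotate]
  simp only [List.getElem_ofFn, Function.comp_apply, Equiv.coe_addRight]
  congr 1
  ext
  simp [Fin.val_add]

lemma sum_perm_Z_rotate {m : ℕ} [NeZero m] (a : Fin m → ℕ) (k : ℕ) :
    ∑ σ : Equiv.Perm (Fin m), Z ((List.ofFn (a ∘ σ)).rotate k) =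
      ∑ σ : Equiv.Perm (Fin m), Z (List.ofFn (a ∘ σ)) := by
  refine Fintype.sum_equiv (Equiv.mulRight (Equiv.addRight (Fin.ofNat m k))) _ _ fun σ => ?_
  rw [rotate_ofFn]
  rfl

end Blocks

/-- **Symmetric insertion.** For nonnegative integers `a₀, …, a_{2n}` and
`wt = 4n + 2(a₀ + ⋯ + a_{2n})`, the sum over all permutations `σ` of `{0, …, 2n}` of
`Z(a_{σ(0)}, …, a_{σ(2n)})` is a rational multiple of `π ^ wt`. -/
theorem symmetric_insertion (n : ℕ) (a : Fin (2 * n + 1) → ℕ) :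
    ∃ q : ℚ,
      ∑ σ : Equiv.Perm (Fin (2 * n + 1)), Z (List.ofFn (a ∘ σ))
        = q * Real.pi ^ (4 * n + 2 * ∑ i, a i) := by
  set w := 4 * n + 2 * ∑ i, a i with hw
  have hcyc : ∀ σ : Equiv.Perm (Fin (2 * n + 1)),
      ∑ k ∈ Finset.range (2 * n + 1), Z ((List.ofFn (a ∘ σ)).rotate (k + 1)) =
        Real.pi ^ w / (w + 1).factorial := by
    intro σ
    have hM : 2 * ((List.ofFn (a ∘ σ)).map (· + 1)).sum = w + 2 := by
      rw [List.map_ofFn, List.sum_ofFn]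
      simp only [Function.comp_apply, Finset.sum_add_distrib]
      rw [Equiv.sum_comp σ a, hw]
      simp
      ring
    have h := sum_Z_rotate (bs := List.ofFn (a ∘ σ)) (by simp [Nat.bodd_mul])
    rwa [List.length_ofFn, hM] at h
  have hsum : ((2 * n + 1 : ℕ) : ℝ) * ∑ σ : Equiv.Perm (Fin (2 * n + 1)), Z (List.ofFn (a ∘ σ)) =
      (2 * n + 1).factorial * (Real.pi ^ w / (w + 1).factorial) := by
    have h := Finset.sum_congr (rfl : (Finset.univ : Finset (Equiv.Perm (Fin (2 * n + 1)))) = _)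
      fun σ _ => hcyc σ
    rw [Finset.sum_comm] at h
    simpa only [sum_perm_Z_rotate, Finset.sum_const, Finset.card_range, Finset.card_univ,
      Fintype.card_perm, Fintype.card_fin, nsmul_eq_mul] using h
  refine ⟨(2 * n).factorial / (w + 1).factorial, ?_⟩
  have hn : ((2 * n + 1 : ℕ) : ℝ) ≠ 0 := by positivity
  refine mul_left_cancel₀ hn ?_
  rw [hsum, Nat.factorial_succ]
  push_cast
  ring
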